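/- arXiv:2102.04900 — 2 statements merged into one kernel-verified Lean document; each statement's English description precedes it below -/
import Mathlib

section
/- Suppose x₀ = y₀, and let λ₁, λ₂ be the eigenvalues of D²u₀(x₀) (both negative) with λ₁ < λ₂, v₁ a unit eigenvector for λ₁. Suppose for each small ε > 0, z_ε ∈ Ω_ε is a critical point of u_ε (∇u_ε(z_ε) = 0) such that |log ε|·|z_ε − x₀|² → −u₀(x₀)/λ₁ and (z_ε − x₀)/|z_ε − x₀| → v₁ as ε → 0⁺. Then there exists ε₀ > 0 such that for all ε ∈ (0, ε₀), det D²u_ε(z_ε) < 0; in particular z_ε is a saddle point of u_ε and not a local maximum. -/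
open Real Set Metric Filter Topology

noncomputable section

abbrev E2 := EuclideanSpace ℝ (Fin 2)

/-- Second partial derivative `∂²u/∂xᵢ∂xⱼ` at `x`. -/
noncomputable def pd2 (u : E2 → ℝ) (x : E2) (i j : Fin 2) : ℝ :=
  fderiv ℝ (fun y => fderiv ℝ u y (EuclideanSpace.single j 1)) x (EuclideanSpace.single i 1)

/-- The Hessian matrix `D²u(x)`. -/
noncomputable def Hess (u : E2 → ℝ) (x : E2) : Matrix (Fin 2) (Fin 2) ℝ :=
  Matrix.of fun i j => pd2 u x i j

/-- The Laplacian `Δu(x)`. -/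
noncomputable def lap (u : E2 → ℝ) (x : E2) : ℝ := pd2 u x 0 0 + pd2 u x 1 1

/-- The largest eigenvalue of a symmetric 2×2 real matrix. -/
noncomputable def lambdaMax (M : Matrix (Fin 2) (Fin 2) ℝ) : ℝ :=
  ((M 0 0 + M 1 1) + Real.sqrt ((M 0 0 - M 1 1) ^ 2 + (M 0 1 + M 1 0) ^ 2)) / 2

/-- `u` is the torsion function of `U`: continuous up to the boundary, `C²` inside,
`Δu = -1` in `U` and `u = 0` on `∂U`. -/
def IsTorsion (U : Set E2) (u : E2 → ℝ) : Prop :=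
  ContinuousOn u (closure U) ∧ (∀ x ∈ U, ContDiffAt ℝ 2 u x) ∧
    (∀ x ∈ U, lap u x = -1) ∧ (∀ x ∈ frontier U, u x = 0)


/-- The complex derivative `∂ₓw - i ∂ᵧw` of a real function on the plane. -/
def cpartial (w : ℂ → ℝ) (ζ : ℂ) : ℂ := fderiv ℝ w ζ 1 - Complex.I * fderiv ℝ w ζ Complex.I

/-- Weak maximum principle for harmonic functions on bounded plane open sets. -/
theorem harmonic_nonpos_of_frontier_nonpos {h : ℂ → ℝ} {U : Set ℂ} (hUo : IsOpen U)
    (hUb : Bornology.IsBounded U) (hh : InnerProductSpace.HarmonicContOnCl h U)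
    (hf : ∀ x ∈ frontier U, h x ≤ 0) : ∀ x ∈ U, h x ≤ 0 := by
  intro a ha
  by_contra! hpos
  have hc : IsCompact (closure U) := hUb.isCompact_closure
  obtain ⟨p, hp, hmax⟩ := hc.exists_isMaxOn ⟨a, subset_closure ha⟩ hh.2
  have hpa : h a ≤ h p := hmax (subset_closure ha)
  set S : Set ℂ := {x ∈ closure U | h x = h p} with hS
  have hSU : ∀ x ∈ S, x ∈ U := by
    rintro x ⟨hx, hxp⟩
    by_contra hxU
    have : x ∈ frontier U := by rw [hUo.frontier_eq]; exact ⟨hx, hxU⟩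
    linarith [hf x this]
  have hSc : IsClosed S := by
    have : S = closure U ∩ h ⁻¹' {h p} := by ext; simp [hS]
    rw [this]
    exact hh.2.preimage_isClosed_of_isClosed isClosed_closure isClosed_singleton
  have hSo : IsOpen S := by
    rw [isOpen_iff_mem_nhds]
    intro x hx
    obtain ⟨r, hr, hrU⟩ := Metric.isOpen_iff.1 hUo x (hSU x hx)
    obtain ⟨F, hF, hFh⟩ := InnerProductSpace.HarmonicOnNhd.exists_analyticOnNhd_ball_re_eq
      (hh.1.mono hrU)
    have hb : ball x r ∈ 𝓝 x := ball_mem_nhds x hr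
    have hloc : IsLocalMax (norm ∘ fun z => Complex.exp (F z)) x := by
      filter_upwards [hb] with y hy
      have h1 := hFh hy
      have h2 := hFh (mem_ball_self hr)
      simp only at h1 h2
      simp only [Function.comp, Complex.norm_exp, h1, h2, hx.2]
      exact Real.exp_le_exp.2 (hmax (subset_closure (hrU hy)))
    have hd : ∀ᶠ z in 𝓝 x, DifferentiableAt ℂ (fun z => Complex.exp (F z)) z := by
      filter_upwards [hb] with y hy
      exact (hF y hy).differentiableAt.cexp
    filter_upwards [Complex.eventually_eq_of_isLocalMax_norm hd hloc, hb] with y hy hyb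
    refine ⟨subset_closure (hrU hyb), ?_⟩
    have h1 := hFh hyb
    have h2 := hFh (mem_ball_self hr)
    simp only at h1 h2
    have := congrArg norm hy
    rw [Complex.norm_exp, Complex.norm_exp, h1, h2, Real.exp_eq_exp] at this
    rw [this, hx.2]
  have huniv : S = univ := IsClopen.eq_univ ⟨hSc, hSo⟩ ⟨p, hp, rfl⟩
  have hb : Bornology.IsBounded (univ : Set ℂ) := huniv ▸ hUb.subset hSU
  exact NormedSpace.unbounded_univ ℝ ℂ hb

/-- Interior gradient estimate for bounded harmonic functions. -/
theorem norm_cpartial_le {w : ℂ → ℝ} {c : ℂ} {R M : ℝ} (hR : 0 < R) (hM : 0 < M)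
    (hw : InnerProductSpace.HarmonicOnNhd w (ball c R)) (hb : ∀ x ∈ ball c R, |w x| ≤ M) :
    ‖cpartial w c‖ ≤ 18 * M / R := by
  obtain ⟨F, hF, hFw⟩ := InnerProductSpace.HarmonicOnNhd.exists_analyticOnNhd_ball_re_eq hw
  have hcb : c ∈ ball c R := mem_ball_self hR
  have hFc : DifferentiableAt ℂ F c := (hF c hcb).differentiableAt
  have hP : cpartial w c = deriv F c := by
    have he : w =ᶠ[𝓝 c] fun z => Complex.reCLM (F z) := by
      filter_upwards [ball_mem_nhds c hR] with y hy
      exact (hFw hy).symm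
    have hd : HasFDerivAt (fun z => Complex.reCLM (F z))
        (Complex.reCLM.comp ((ContinuousLinearMap.toSpanSingleton ℂ (deriv F c)).restrictScalars ℝ))
        c :=
      Complex.reCLM.hasFDerivAt.comp c (hFc.hasDerivAt.hasFDerivAt.restrictScalars ℝ)
    rw [cpartial, he.fderiv_eq, hd.fderiv]
    apply Complex.ext <;> simp
  set G : ℂ → ℂ := fun z => Complex.exp (F z / M) with hG
  have hnorm : ∀ x ∈ ball c R, ‖G x‖ = Real.exp (w x / M) := by
    intro x hx
    have := hFw hx
    simp only at this
    rw [hG, Complex.norm_exp, ← this, Complex.div_ofReal_re]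
  have hGd : HasDerivAt G (G c * (deriv F c / M)) c := (hFc.hasDerivAt.div_const (M : ℂ)).cexp
  have hsub : closedBall c (R / 2) ⊆ ball c R := closedBall_subset_ball (by linarith)
  have hcl : DiffContOnCl ℂ G (ball c (R / 2)) := by
    apply DifferentiableOn.diffContOnCl
    rw [closure_ball c (by positivity)]
    intro x hx
    exact ((hF x (hsub hx)).differentiableAt.div_const (M : ℂ)).cexp.differentiableWithinAt
  have h1 : ‖deriv G c‖ ≤ Real.exp 1 / (R / 2) := by
    refine Complex.norm_deriv_le_of_forall_mem_sphere_norm_le (by positivity) hcl fun z hz => ?_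
    have hz' := hsub (sphere_subset_closedBall hz)
    rw [hnorm z hz']
    apply Real.exp_le_exp.2
    rw [div_le_one hM]
    exact (abs_le.1 (hb z hz')).2
  have h2 : Real.exp (-1) ≤ ‖G c‖ := by
    rw [hnorm c hcb]
    apply Real.exp_le_exp.2
    rw [le_div_iff₀ hM]
    linarith [(abs_le.1 (hb c hcb)).1]
  rw [hGd.deriv, norm_mul, norm_div, Complex.norm_real, Real.norm_of_nonneg hM.le] at h1
  have h3 : Real.exp (-1) * (‖deriv F c‖ / M) ≤ Real.exp 1 / (R / 2) :=
    (mul_le_mul_of_nonneg_right h2 (by positivity)).trans h1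
  have he : Real.exp 1 * Real.exp 1 ≤ 9 := by
    nlinarith [Real.exp_one_lt_d9, Real.exp_pos 1]
  have hee : Real.exp 1 * Real.exp (-1) = 1 := by rw [← Real.exp_add]; simp
  rw [hP, le_div_iff₀ hR]
  have h4 : Real.exp 1 * (Real.exp (-1) * (‖deriv F c‖ / M)) ≤
      Real.exp 1 * (Real.exp 1 / (R / 2)) := mul_le_mul_of_nonneg_left h3 (Real.exp_pos 1).le
  rw [← mul_assoc, hee, one_mul, ← mul_div_assoc, div_le_div_iff₀ hM (by positivity)] at h4
  nlinarith

/-- Cauchy's estimate for the derivative of a holomorphic function on an annulus. -/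
theorem norm_deriv_le_of_annulus {g : ℂ → ℂ} {U : Set ℂ} {s ρ A B : ℝ} {z : ℂ} (hU : IsOpen U)
    (hs : 0 < s) (hsz : s < ‖z‖) (hzρ : ‖z‖ < ρ) (hsub : closedBall 0 ρ \ ball 0 s ⊆ U)
    (hg : DifferentiableOn ℂ g U) (hA : ∀ ζ ∈ sphere (0 : ℂ) ρ, ‖g ζ‖ ≤ A)
    (hB : ∀ ζ ∈ sphere (0 : ℂ) s, ‖g ζ‖ ≤ B) :
    ‖deriv g z‖ ≤ ρ * (A / (ρ - ‖z‖) ^ 2) + s * (B / (‖z‖ - s) ^ 2) := by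
  have hρ : 0 < ρ := by linarith
  have hzU : z ∈ U := hsub (by simp [hzρ.le, hsz.le])
  have hUz : U ∈ 𝓝 z := hU.mem_nhds hzU
  have hψ : DifferentiableOn ℂ (dslope (dslope g z) z) U :=
    (Complex.differentiableOn_dslope hUz).2 ((Complex.differentiableOn_dslope hUz).2 hg)
  have hval : ∀ ζ, ζ ≠ z → dslope (dslope g z) z ζ =
      (ζ - z) ^ (-2 : ℤ) * g ζ - g z * (ζ - z) ^ (-2 : ℤ) - deriv g z * (ζ - z)⁻¹ := by
    intro ζ hζ
    have : ζ - z ≠ 0 := sub_ne_zero.2 hζ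
    rw [dslope_of_ne _ hζ, slope_def_field, dslope_of_ne _ hζ, slope_def_field, dslope_same]
    rw [zpow_neg]
    field_simp
  have heq := Complex.circleIntegral_eq_of_differentiable_on_annulus_off_countable
    (c := 0) hs (hsz.trans hzρ).le countable_empty (f := dslope (dslope g z) z)
    (hψ.continuousOn.mono hsub) (fun x hx => hψ.differentiableAt (hU.mem_nhds (hsub
      ⟨ball_subset_closedBall hx.1.1, fun h => hx.1.2 (ball_subset_closedBall h)⟩)))
  have hsplit : ∀ t, 0 < t → t ≠ ‖z‖ → sphere (0 : ℂ) t ⊆ U →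
      (∮ ζ in C(0, t), dslope (dslope g z) z ζ) =
        (∮ ζ in C(0, t), (ζ - z) ^ (-2 : ℤ) * g ζ) - deriv g z * ∮ ζ in C(0, t), (ζ - z)⁻¹ := by
    intro t ht htz htU
    have hne : ∀ ζ ∈ sphere (0 : ℂ) t, ζ ≠ z := by
      rintro ζ hζ rfl
      exact htz (by simpa using hζ.symm)
    have hz : z ∉ sphere (0 : ℂ) |t| := by
      rw [abs_of_pos ht]; exact fun h => hne z h rfl
    have i1 : CircleIntegrable (fun ζ => (ζ - z) ^ (-2 : ℤ) * g ζ) 0 t := by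
      refine ContinuousOn.circleIntegrable ht.le (ContinuousOn.mul ?_ (hg.continuousOn.mono htU))
      exact (continuousOn_id.sub continuousOn_const).zpow₀ _
        fun ζ hζ => Or.inl (sub_ne_zero.2 (hne ζ hζ))
    have i2 : CircleIntegrable (fun ζ => g z * (ζ - z) ^ (-2 : ℤ)) 0 t :=
      (circleIntegrable_sub_zpow_iff.2 (Or.inr (Or.inr hz))).const_fun_smul (a := g z)
    have i3 : CircleIntegrable (fun ζ => deriv g z * (ζ - z)⁻¹) 0 t :=
      (circleIntegrable_sub_inv_iff.2 (Or.inr hz)).const_fun_smul (a := deriv g z)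
    have i12 : CircleIntegrable
        (fun ζ => (ζ - z) ^ (-2 : ℤ) * g ζ - g z * (ζ - z) ^ (-2 : ℤ)) 0 t := i1.sub i2
    rw [circleIntegral.integral_congr ht.le fun ζ hζ => hval ζ (hne ζ hζ),
      circleIntegral.integral_sub i12 i3, circleIntegral.integral_sub i1 i2,
      circleIntegral.integral_const_mul, circleIntegral.integral_const_mul,
      circleIntegral.integral_sub_zpow_of_ne (by norm_num)]
    ring
  have hUs : sphere (0 : ℂ) s ⊆ U := fun x hx => hsub (by
    simp only [mem_sphere_zero_iff_norm] at hx
    simp [hx]; linarith)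
  have hUρ : sphere (0 : ℂ) ρ ⊆ U := fun x hx => hsub (by
    simp only [mem_sphere_zero_iff_norm] at hx
    simp [hx]; linarith)
  have h0 : (∮ ζ in C(0, s), (ζ - z)⁻¹) = 0 := by
    refine Complex.circleIntegral_eq_zero_of_differentiable_on_off_countable hs.le
      countable_empty ?_ ?_
    · intro x hx
      have : x - z ≠ 0 := sub_ne_zero.2 (by rintro rfl; simp at hx; linarith)
      exact ((continuousAt_id.sub continuousAt_const).inv₀ this).continuousWithinAt
    · intro x hx
      have : x - z ≠ 0 := sub_ne_zero.2 (by rintro rfl; simp at hx; linarith)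
      exact (differentiableAt_id.sub_const z).inv this
  rw [hsplit s hs hsz.ne hUs, hsplit ρ hρ hzρ.ne' hUρ, h0,
    circleIntegral.integral_sub_inv_of_mem_ball (by simpa using hzρ)] at heq
  have b1 : ‖∮ ζ in C(0, ρ), (ζ - z) ^ (-2 : ℤ) * g ζ‖ ≤ 2 * π * ρ * (A / (ρ - ‖z‖) ^ 2) := by
    refine circleIntegral.norm_integral_le_of_norm_le_const hρ.le fun ζ hζ => ?_
    have h1 : ρ - ‖z‖ ≤ ‖ζ - z‖ := by
      have := norm_sub_norm_le ζ z
      rwa [mem_sphere_zero_iff_norm.1 hζ] at this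
    have h2 : 0 < ρ - ‖z‖ := by linarith
    rw [norm_mul, norm_zpow, zpow_neg, ← div_eq_inv_mul]
    exact div_le_div₀ ((norm_nonneg _).trans (hA ζ hζ)) (hA ζ hζ) (by positivity)
      (by exact_mod_cast pow_le_pow_left₀ h2.le h1 2)
  have b2 : ‖∮ ζ in C(0, s), (ζ - z) ^ (-2 : ℤ) * g ζ‖ ≤ 2 * π * s * (B / (‖z‖ - s) ^ 2) := by
    refine circleIntegral.norm_integral_le_of_norm_le_const hs.le fun ζ hζ => ?_
    have h1 : ‖z‖ - s ≤ ‖ζ - z‖ := by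
      have := norm_sub_norm_le z ζ
      rwa [mem_sphere_zero_iff_norm.1 hζ, norm_sub_rev] at this
    have h2 : 0 < ‖z‖ - s := by linarith
    rw [norm_mul, norm_zpow, zpow_neg, ← div_eq_inv_mul]
    exact div_le_div₀ ((norm_nonneg _).trans (hB ζ hζ)) (hB ζ hζ) (by positivity)
      (by exact_mod_cast pow_le_pow_left₀ h2.le h1 2)
  have hmain : deriv g z * (2 * π * Complex.I) = (∮ ζ in C(0, ρ), (ζ - z) ^ (-2 : ℤ) * g ζ) -
      ∮ ζ in C(0, s), (ζ - z) ^ (-2 : ℤ) * g ζ := by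
    linear_combination -heq
  have hn := norm_sub_le (∮ ζ in C(0, ρ), (ζ - z) ^ (-2 : ℤ) * g ζ)
    (∮ ζ in C(0, s), (ζ - z) ^ (-2 : ℤ) * g ζ)
  rw [← hmain, norm_mul] at hn
  have hpi : ‖(2 * π * Complex.I : ℂ)‖ = 2 * π := by
    simp [abs_of_pos Real.pi_pos]
  rw [hpi] at hn
  have : 2 * π * ‖deriv g z‖ ≤
      2 * π * (ρ * (A / (ρ - ‖z‖) ^ 2) + s * (B / (‖z‖ - s) ^ 2)) := by linarith
  exact le_of_mul_le_mul_left this (by positivity)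


/-- `u` is the torsion function of the plane set `U`, with `ℂ` as the model of the plane. -/
def IsPlaneTorsion (U : Set ℂ) (u : ℂ → ℝ) : Prop :=
  ContinuousOn u (closure U) ∧ (∀ x ∈ U, ContDiffAt ℝ 2 u x) ∧
    (∀ x ∈ U, Laplacian.laplacian u x = -1) ∧ (∀ x ∈ frontier U, u x = 0)

/-- The difference of two functions with Laplacian `-1` is harmonic. -/
theorem IsPlaneTorsion.harmonicContOnCl_sub {Ω U : Set ℂ} {u v : ℂ → ℝ} (hu : IsPlaneTorsion Ω u)
    (hv : IsPlaneTorsion U v) (hU : IsOpen U) (hUΩ : U ⊆ Ω) :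
    InnerProductSpace.HarmonicContOnCl (u - v) U := by
  refine ⟨fun x hx => ⟨(hu.2.1 x (hUΩ hx)).sub (hv.2.1 x hx), ?_⟩,
    (hu.1.mono (closure_mono hUΩ)).sub hv.1⟩
  filter_upwards [hU.mem_nhds hx] with y hy
  rw [ContDiffAt.laplacian_sub (hu.2.1 y (hUΩ hy)) (hv.2.1 y hy), hu.2.2.1 y (hUΩ hy),
    hv.2.2.1 y hy]
  simp

/-- Comparison with a logarithmic barrier: removing a small disc perturbs the torsion function
by at most a logarithmic profile. -/
theorem IsPlaneTorsion.sub_mem_Icc {Ω : Set ℂ} {u v : ℂ → ℝ} {m R ε : ℝ} (hΩ : IsOpen Ω)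
    (hR : 1 ≤ R) (hΩR : Ω ⊆ ball 0 R) (hε : 0 < ε) (hε1 : ε < 1) (hu : IsPlaneTorsion Ω u)
    (hv : IsPlaneTorsion (Ω \ closedBall 0 ε) v) (hpos : ∀ x ∈ Ω, 0 ≤ u x)
    (hm : ∀ x ∈ Ω, u x ≤ m) (hm0 : 0 ≤ m) {x : ℂ} (hx : x ∈ Ω \ closedBall 0 ε) :
    u x - v x ∈ Icc 0 (m / -Real.log ε * (Real.log R - Real.log ‖x‖)) := by
  set U := Ω \ closedBall (0 : ℂ) ε with hUdef
  have hUo : IsOpen U := hΩ.sdiff isClosed_closedBall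
  have hUb : Bornology.IsBounded U := isBounded_ball.subset (sdiff_subset.trans hΩR)
  have hw := hu.harmonicContOnCl_sub hv hUo sdiff_subset
  have hlog : 0 < -Real.log ε := by linarith [Real.log_neg hε hε1]
  set k := m / -Real.log ε with hk
  have hk0 : 0 ≤ k := div_nonneg hm0 hlog.le
  have hcl : ∀ p ∈ closure U, ε ≤ ‖p‖ := by
    have : closure U ⊆ {p : ℂ | ε ≤ ‖p‖} := by
      refine closure_minimal (fun p hp => ?_) (isClosed_le continuous_const continuous_norm)
      have := hp.2
      simp only [mem_closedBall_zero_iff, not_le] at this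
      exact this.le
    exact this
  have hfr : ∀ p ∈ frontier U, v p = 0 ∧ (p ∈ Ω ∧ ‖p‖ = ε ∨ u p = 0) := by
    intro p hp
    refine ⟨hv.2.2.2 p hp, ?_⟩
    have hpc := frontier_subset_closure hp
    by_cases hpΩ : p ∈ Ω
    · refine Or.inl ⟨hpΩ, le_antisymm ?_ (hcl p hpc)⟩
      by_contra h
      rw [hUo.frontier_eq] at hp
      exact hp.2 ⟨hpΩ, by simpa using h⟩
    · refine Or.inr (hu.2.2.2 p ?_)
      rw [hΩ.frontier_eq]
      exact ⟨closure_mono sdiff_subset hpc, hpΩ⟩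
  have hlow := harmonic_nonpos_of_frontier_nonpos hUo hUb hw.neg (fun p hp => by
    obtain ⟨h1, h2⟩ := hfr p hp
    simp only [Pi.neg_apply, Pi.sub_apply, h1]
    rcases h2 with h2 | h2
    · linarith [hpos p h2.1]
    · simp [h2]) x hx
  have hlogh : InnerProductSpace.HarmonicContOnCl (fun z : ℂ => Real.log ‖z‖) U := by
    apply InnerProductSpace.HarmonicOnNhd.harmonicContOnCl
    intro p hp
    have hp0 : p ≠ 0 := norm_pos_iff.1 (hε.trans_le (hcl p hp))
    exact analyticAt_id.harmonicAt_log_norm hp0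
  have hbar := (hw.add (hlogh.const_smul k)).sub_const (k * Real.log R)
  have hup := harmonic_nonpos_of_frontier_nonpos hUo hUb hbar (fun p hp => by
    obtain ⟨h1, h2⟩ := hfr p hp
    have hpc := frontier_subset_closure hp
    simp only [Pi.add_apply, Pi.sub_apply, Pi.smul_apply, smul_eq_mul, h1]
    rcases h2 with ⟨hpΩ, hpε⟩ | h2
    · have h3 : k * -Real.log ε = m := div_mul_cancel₀ _ hlog.ne'
      have h4 : 0 ≤ k * Real.log R := mul_nonneg hk0 (Real.log_nonneg hR)
      rw [hpε]
      linarith [hm p hpΩ]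
    · have hpR : ‖p‖ ≤ R := by
        have : closure U ⊆ closedBall 0 R :=
          closure_minimal ((sdiff_subset.trans hΩR).trans ball_subset_closedBall)
            isClosed_closedBall
        simpa using this hpc
      have h3 := Real.log_le_log (hε.trans_le (hcl p hpc)) hpR
      rw [h2]
      nlinarith) x hx
  simp only [Pi.neg_apply, Pi.sub_apply, Pi.add_apply, Pi.smul_apply, smul_eq_mul] at hlow hup
  exact ⟨by linarith, by linarith⟩

/-- Away from the hole, `ζ ∂(u - v)(ζ)` has a small derivative: the only non-small Laurent
coefficient of this function is the constant one. -/
theorem IsPlaneTorsion.norm_deriv_mul_cpartial_le {Ω : Set ℂ} {u v : ℂ → ℝ} {m R ρ ε : ℝ}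
    (hΩ : IsOpen Ω) (hR : 1 ≤ R) (hΩR : Ω ⊆ ball 0 R) (hρ : 0 < ρ)
    (hρΩ : closedBall 0 (2 * ρ) ⊆ Ω) (hε : 0 < ε) (hε1 : ε < 1)
    (hεR : Real.log R ≤ -Real.log ε) (hu : IsPlaneTorsion Ω u)
    (hv : IsPlaneTorsion (Ω \ closedBall 0 ε) v) (hpos : ∀ x ∈ Ω, 0 ≤ u x)
    (hm : ∀ x ∈ Ω, u x ≤ m) (hm0 : 0 < m) {z : ℂ} (hεz : 4 * ε ≤ ‖z‖) (hzρ : ‖z‖ ≤ ρ / 2) :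
    ‖deriv (fun ζ => ζ * cpartial (u - v) ζ) z‖ ≤
      144 * m * (Real.log R - Real.log (ρ / 2)) / ρ * (-Real.log ε)⁻¹ +
        576 * m * (ε / ‖z‖ ^ 2) := by
  have hUo : IsOpen (Ω \ closedBall (0 : ℂ) ε) := hΩ.sdiff isClosed_closedBall
  have hw := (hu.harmonicContOnCl_sub hv hUo sdiff_subset).1
  have hlog : 0 < -Real.log ε := by linarith [Real.log_neg hε hε1]
  have hbd := fun x hx => IsPlaneTorsion.sub_mem_Icc hΩ hR hΩR hε hε1 hu hv hpos hm hm0.le (x := x) hx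
  have hk : 0 < m / -Real.log ε := div_pos hm0 hlog
  have hρR : ρ / 2 < R := by
    have h1 : (ρ : ℂ) ∈ Ω := hρΩ (by simp [abs_of_pos hρ]; linarith)
    have h2 := hΩR h1
    simp [abs_of_pos hρ] at h2
    linarith
  have hlogρ : Real.log (ρ / 2) < Real.log R := Real.log_lt_log (by positivity) hρR
  have hball : ∀ c : ℂ, ∀ r t : ℝ, ε ≤ t → r + t ≤ ‖c‖ → ‖c‖ + r ≤ 2 * ρ → ∀ x ∈ ball c r,
      x ∈ Ω \ closedBall 0 ε ∧
        |(u - v) x| ≤ m / -Real.log ε * (Real.log R - Real.log t) := by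
    intro c r t ht h1 h2 x hx
    rw [mem_ball_iff_norm] at hx
    have h3 := norm_sub_norm_le c x
    rw [norm_sub_rev] at h3
    have h4 := norm_sub_norm_le x c
    have hxt : t < ‖x‖ := by linarith
    have hxU : x ∈ Ω \ closedBall 0 ε := ⟨hρΩ (by simp; linarith), by simp; linarith⟩
    have h5 := hbd x hxU
    refine ⟨hxU, ?_⟩
    rw [Pi.sub_apply, abs_of_nonneg h5.1]
    refine h5.2.trans ?_
    have := Real.log_le_log (hε.trans_le ht) hxt.le
    exact mul_le_mul_of_nonneg_left (by linarith) hk.le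
  set M := m / -Real.log ε * (Real.log R - Real.log (ρ / 2)) with hM
  have hM0 : 0 < M := mul_pos hk (by linarith)
  have hA : ∀ ζ ∈ sphere (0 : ℂ) ρ, ‖ζ * cpartial (u - v) ζ‖ ≤ 36 * M := by
    intro ζ hζ
    rw [mem_sphere_zero_iff_norm] at hζ
    have hb := hball ζ (ρ / 2) (ρ / 2) (by linarith) (by linarith) (by linarith)
    have := norm_cpartial_le (by positivity) hM0 (hw.mono fun x hx => (hb x hx).1)
      fun x hx => (hb x hx).2
    rw [norm_mul, hζ]
    calc ρ * ‖cpartial (u - v) ζ‖ ≤ ρ * (18 * M / (ρ / 2)) :=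
          mul_le_mul_of_nonneg_left this hρ.le
      _ = 36 * M := by field_simp; norm_num
  have hB : ∀ ζ ∈ sphere (0 : ℂ) (2 * ε), ‖ζ * cpartial (u - v) ζ‖ ≤ 72 * m := by
    intro ζ hζ
    rw [mem_sphere_zero_iff_norm] at hζ
    have hb := hball ζ ε ε le_rfl (by linarith) (by linarith)
    have hle : m / -Real.log ε * (Real.log R - Real.log ε) ≤ 2 * m := by
      rw [div_mul_eq_mul_div, div_le_iff₀ hlog]
      nlinarith
    have := norm_cpartial_le hε (M := 2 * m) (by positivity) (hw.mono fun x hx => (hb x hx).1)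
      fun x hx => (hb x hx).2.trans hle
    rw [norm_mul, hζ]
    calc 2 * ε * ‖cpartial (u - v) ζ‖ ≤ 2 * ε * (18 * (2 * m) / ε) :=
          mul_le_mul_of_nonneg_left this (by positivity)
      _ = 72 * m := by field_simp; norm_num
  have hd : DifferentiableOn ℂ (fun ζ => ζ * cpartial (u - v) ζ) (Ω \ closedBall (0 : ℂ) ε) :=
    fun ζ hζ => (differentiableAt_id.mul
      (HarmonicAt.differentiableAt_complex_partial (hw ζ hζ))).differentiableWithinAt
  have hsub : closedBall (0 : ℂ) ρ \ ball 0 (2 * ε) ⊆ Ω \ closedBall 0 ε := by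
    rintro x ⟨h1, h2⟩
    simp only [mem_closedBall_zero_iff, mem_ball_zero_iff, not_lt] at h1 h2
    exact ⟨hρΩ (by simp; linarith), by simp; linarith⟩
  refine (norm_deriv_le_of_annulus hUo (by positivity) (by linarith) (by linarith) hsub hd
    hA hB).trans (add_le_add ?_ ?_)
  · have h1 : (ρ / 2) ^ 2 ≤ (ρ - ‖z‖) ^ 2 := pow_le_pow_left₀ (by positivity) (by linarith) 2
    calc ρ * (36 * M / (ρ - ‖z‖) ^ 2) ≤ ρ * (36 * M / (ρ / 2) ^ 2) := by gcongr
      _ = _ := by rw [hM]; field_simp; ring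
  · have hz : 0 < ‖z‖ := by linarith
    have h1 : (‖z‖ / 2) ^ 2 ≤ (‖z‖ - 2 * ε) ^ 2 :=
      pow_le_pow_left₀ (by positivity) (by linarith) 2
    calc 2 * ε * (72 * m / (‖z‖ - 2 * ε) ^ 2) ≤ 2 * ε * (72 * m / (‖z‖ / 2) ^ 2) := by gcongr
      _ = _ := by field_simp; norm_num

/-- If `|log ε| r² → c > 0` then `r → 0`, more slowly than any power of `ε`, and faster than
`1 / |log ε|` decays. -/
theorem tendsto_of_log_mul_sq {r : ℝ → ℝ} {c : ℝ} (hc : 0 < c) (hr : ∀ᶠ ε in 𝓝[>] (0 : ℝ), 0 < r ε)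
    (h : Tendsto (fun ε => |Real.log ε| * r ε ^ 2) (𝓝[>] 0) (𝓝 c)) :
    Tendsto r (𝓝[>] 0) (𝓝 0) ∧
    Tendsto (fun ε => (-Real.log ε)⁻¹ / r ε) (𝓝[>] 0) (𝓝 0) ∧
    Tendsto (fun ε => ε / r ε ^ 3) (𝓝[>] 0) (𝓝 0) := by
  have hlog : Tendsto (fun ε => -Real.log ε) (𝓝[>] (0 : ℝ)) atTop :=
    tendsto_neg_atBot_atTop.comp Real.tendsto_log_nhdsGT_zero
  have hinv : Tendsto (fun ε => (-Real.log ε)⁻¹) (𝓝[>] (0 : ℝ)) (𝓝 0) :=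
    tendsto_inv_atTop_zero.comp hlog
  have hLpos : ∀ᶠ ε in 𝓝[>] (0 : ℝ), 0 < -Real.log ε := hlog.eventually_gt_atTop 0
  have hr2 : Tendsto (fun ε => r ε ^ 2) (𝓝[>] 0) (𝓝 0) := by
    have := h.mul hinv
    rw [mul_zero] at this
    refine this.congr' ?_
    filter_upwards [hLpos] with ε hε
    rw [abs_of_neg (by linarith), mul_right_comm, mul_inv_cancel₀ hε.ne', one_mul]
  have hr0 : Tendsto r (𝓝[>] 0) (𝓝 0) := by
    have := (Real.continuous_sqrt.tendsto 0).comp hr2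
    rw [Real.sqrt_zero] at this
    refine this.congr' ?_
    filter_upwards [hr] with ε hε
    exact Real.sqrt_sq hε.le
  have hhalf : Tendsto (fun ε : ℝ => Real.log ε * ε ^ (1 / 2 : ℝ)) (𝓝[>] 0) (𝓝 0) :=
    tendsto_log_mul_rpow_nhdsGT_zero (by norm_num)
  refine ⟨hr0, ?_, ?_⟩
  · have := hr0.div h hc.ne'
    rw [zero_div] at this
    refine this.congr' ?_
    filter_upwards [hLpos, hr] with ε hε hrε
    simp only [Pi.div_apply]
    rw [abs_of_neg (by linarith)]
    field_simp
  · have := ((hhalf.pow 2).mul hr0).div (h.pow 2) (pow_ne_zero 2 hc.ne')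
    simp only [ne_eq, OfNat.ofNat_ne_zero, not_false_eq_true, zero_pow, mul_zero, zero_div] at this
    refine this.congr' ?_
    filter_upwards [hLpos, hr, self_mem_nhdsWithin] with ε hε hrε hε0
    have h1 : (ε ^ (1 / 2 : ℝ)) ^ 2 = ε := by
      rw [← Real.rpow_natCast, ← Real.rpow_mul (le_of_lt hε0)]; norm_num
    have h2 : Real.log ε ≠ 0 := (by linarith : Real.log ε < 0).ne
    simp only [Pi.div_apply]
    rw [mul_pow, mul_pow, h1, sq_abs]
    field_simp

/-- The rescaled derivative of `ζ ∂(u - u_ε)(ζ)` at the points `z_ε` tends to zero. -/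
theorem tendsto_deriv_mul_cpartial_div {Ω : Set ℂ} {u : ℂ → ℝ} {v : ℝ → ℂ → ℝ} {z : ℝ → ℂ}
    {ε₁ c : ℝ} (hΩ : IsOpen Ω) (hΩb : Bornology.IsBounded Ω) (hu : IsPlaneTorsion Ω u)
    (hpos : ∀ x ∈ Ω, 0 < u x) (hmax : ∀ x ∈ Ω, u x ≤ u 0) (hε₁ : 0 < ε₁)
    (hball : closedBall 0 ε₁ ⊆ Ω)
    (hv : ∀ ε ∈ Ioo 0 ε₁, IsPlaneTorsion (Ω \ closedBall 0 ε) (v ε))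
    (hz : ∀ ε ∈ Ioo 0 ε₁, z ε ∈ Ω \ closedBall 0 ε) (hc : 0 < c)
    (h : Tendsto (fun ε => |Real.log ε| * ‖z ε‖ ^ 2) (𝓝[>] 0) (𝓝 c)) :
    Tendsto (fun ε => deriv (fun ζ => ζ * cpartial (u - v ε) ζ) (z ε) / z ε) (𝓝[>] 0) (𝓝 0) := by
  have hIoo : ∀ᶠ ε in 𝓝[>] (0 : ℝ), ε ∈ Ioo 0 ε₁ := Ioo_mem_nhdsGT hε₁
  have hzpos : ∀ᶠ ε in 𝓝[>] (0 : ℝ), 0 < ‖z ε‖ := by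
    filter_upwards [hIoo] with ε hε
    have := (hz ε hε).2
    simp only [mem_closedBall_zero_iff, not_le] at this
    exact hε.1.trans this
  obtain ⟨t1, t2, t3⟩ := tendsto_of_log_mul_sq hc hzpos h
  obtain ⟨S, hS, hΩR⟩ : ∃ S : ℝ, 1 ≤ S ∧ Ω ⊆ ball 0 S := by
    obtain ⟨R, hR⟩ := hΩb.subset_ball 0
    exact ⟨max R 1, le_max_right _ _, hR.trans (ball_subset_ball (le_max_left _ _))⟩
  set ρ := ε₁ / 2 with hρdef
  have hρ : 0 < ρ := by positivity
  have hρΩ : closedBall (0 : ℂ) (2 * ρ) ⊆ Ω := by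
    rw [hρdef, mul_div_cancel₀ _ two_ne_zero]; exact hball
  have h0 : 0 < u 0 := hpos 0 (hball (by simp [hε₁.le]))
  have hlog : Tendsto (fun ε => -Real.log ε) (𝓝[>] (0 : ℝ)) atTop :=
    tendsto_neg_atBot_atTop.comp Real.tendsto_log_nhdsGT_zero
  rw [tendsto_zero_iff_norm_tendsto_zero]
  have hlim := (t2.const_mul (144 * u 0 * (Real.log S - Real.log (ρ / 2)) / ρ)).add
    (t3.const_mul (576 * u 0))
  rw [mul_zero, mul_zero, add_zero] at hlim
  refine squeeze_zero' (Eventually.of_forall fun _ => norm_nonneg _) ?_ hlim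
  filter_upwards [hIoo, hzpos, hlog.eventually_ge_atTop (Real.log S),
    t1.eventually_le_const (show (0 : ℝ) < ρ / 2 by positivity),
    t1.eventually_le_const (show (0 : ℝ) < 1 / 2 by positivity),
    t3.eventually_le_const one_pos,
    Ioo_mem_nhdsGT (one_pos : (0 : ℝ) < 1)] with ε e1 e2 e3 e4 e5 e6 e7
  have hεz : 4 * ε ≤ ‖z ε‖ := by
    rw [div_le_one (by positivity)] at e6
    nlinarith [mul_pos e2 e2]
  have := IsPlaneTorsion.norm_deriv_mul_cpartial_le hΩ hS hΩR hρ hρΩ e1.1 e7.2 e3 hu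
    (hv ε e1) (fun x hx => (hpos x hx).le) hmax h0 hεz e4
  rw [norm_div, div_le_iff₀ e2]
  refine this.trans (le_of_eq ?_)
  field_simp


theorem fderiv_fderiv_apply_eq {E : Type*} [NormedAddCommGroup E] [NormedSpace ℝ E] {φ : E → ℝ}
    {x : E} (h : ContDiffAt ℝ 2 φ x) (a b : E) :
    fderiv ℝ (fun y => fderiv ℝ φ y b) x a = fderiv ℝ (fderiv ℝ φ) x a b := by
  have hd : DifferentiableAt ℝ (fderiv ℝ φ) x :=
    (h.fderiv_right (m := 1) (by norm_num)).differentiableAt one_ne_zero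
  simp [fderiv_clm_apply hd (differentiableAt_const b)]

/-- Second-order necessary condition at a local maximum. -/
theorem IsLocalMax.fderiv_fderiv_nonpos {E : Type*} [NormedAddCommGroup E] [NormedSpace ℝ E]
    {φ : E → ℝ} {z : E} (hmax : IsLocalMax φ z) (hφ : ContDiffAt ℝ 2 φ z) (v : E) :
    fderiv ℝ (fderiv ℝ φ) z v v ≤ 0 := by
  by_contra! hpos
  set f : ℝ → ℝ := fun t => φ (z + t • v) with hf
  have hl : ∀ t : ℝ, HasDerivAt (fun t : ℝ => z + t • v) v t := fun t => by
    simpa using ((hasDerivAt_id t).smul_const v).const_add z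
  have hlc : Tendsto (fun t : ℝ => z + t • v) (𝓝 0) (𝓝 z) := by
    simpa using (hl 0).continuousAt.tendsto
  have h1 : deriv f =ᶠ[𝓝 0] fun t => fderiv ℝ φ (z + t • v) v := by
    filter_upwards [hlc.eventually (hφ.eventually (by simp))] with t ht
    exact ((ht.differentiableAt two_ne_zero).hasFDerivAt.comp_hasDerivAt t (hl t)).deriv
  have hd : DifferentiableAt ℝ (fderiv ℝ φ) z :=
    (hφ.fderiv_right (m := 1) (by norm_num)).differentiableAt one_ne_zero
  have hz : z + (0 : ℝ) • v = z := by simp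
  have h2 : deriv (deriv f) 0 = fderiv ℝ (fderiv ℝ φ) z v v := by
    rw [h1.deriv_eq, ← fderiv_fderiv_apply_eq hφ]
    have h3 : HasFDerivAt (fun y => fderiv ℝ φ y v) (fderiv ℝ (fun y => fderiv ℝ φ y v) z)
        (z + (0 : ℝ) • v) := by
      rw [hz]; exact (hd.clm_apply (differentiableAt_const v)).hasFDerivAt
    exact (h3.comp_hasDerivAt (0 : ℝ) (hl 0)).deriv
  have hfmax : IsLocalMax f 0 := by
    filter_upwards [hlc.eventually hmax] with t ht
    simpa [hf] using ht
  have hfc : ContinuousAt f 0 := by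
    have : ContinuousAt φ (z + (0 : ℝ) • v) := by rw [hz]; exact hφ.continuousAt
    exact ContinuousAt.comp this (hl 0).continuousAt
  have hfmin := isLocalMin_of_deriv_deriv_pos (h2 ▸ hpos) hfmax.deriv_eq_zero hfc
  have hconst : f =ᶠ[𝓝 0] fun _ => f 0 := by
    filter_upwards [hfmax, hfmin] with t h3 h4 using le_antisymm h3 h4
  have h0 : deriv (deriv f) 0 = 0 := by
    rw [hconst.deriv.deriv_eq]; simp
  linarith

theorem pd2_eq {u : E2 → ℝ} {x : E2} (h : ContDiffAt ℝ 2 u x) (i j : Fin 2) :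
    pd2 u x i j = fderiv ℝ (fderiv ℝ u) x (EuclideanSpace.single i 1)
      (EuclideanSpace.single j 1) :=
  fderiv_fderiv_apply_eq h _ _

theorem pd2_comm {u : E2 → ℝ} {x : E2} (h : ContDiffAt ℝ 2 u x) (i j : Fin 2) :
    pd2 u x i j = pd2 u x j i := by
  rw [pd2_eq h, pd2_eq h]
  exact (h.isSymmSndFDerivAt (by simp)) _ _

/-- A `C²` function whose Hessian has negative determinant has no local maximum there. -/
theorem not_isLocalMax_of_det_Hess_neg {u : E2 → ℝ} {x : E2} (h : ContDiffAt ℝ 2 u x)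
    (hdet : (Hess u x).det < 0) : ¬ IsLocalMax u x := by
  intro hmax
  have hq : ∀ s t : ℝ, s ^ 2 * pd2 u x 0 0 + 2 * s * t * pd2 u x 0 1 + t ^ 2 * pd2 u x 1 1 ≤ 0 := by
    intro s t
    have := hmax.fderiv_fderiv_nonpos h
      (s • EuclideanSpace.single 0 1 + t • EuclideanSpace.single 1 1)
    simp only [map_add, map_smul, add_apply, smul_apply,
      smul_eq_mul, ← pd2_eq h] at this
    rw [pd2_comm h 1 0] at this
    linarith
  rw [Matrix.det_fin_two] at hdet
  simp only [Hess, Matrix.of_apply] at hdet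
  rw [pd2_comm h 1 0] at hdet
  generalize pd2 u x 0 0 = a at *
  generalize pd2 u x 0 1 = b at *
  generalize pd2 u x 1 1 = d at *
  have ha : a ≤ 0 := by have := hq 1 0; linarith
  have ha0 : a = 0 := by
    have := hq b (-a)
    nlinarith
  have hb : b ≠ 0 := by rintro rfl; simp [ha0] at hdet
  have := hq ((1 - d) / (2 * b)) 1
  have e : 2 * ((1 - d) / (2 * b)) * 1 * b = 1 - d := by field_simp
  rw [ha0, e] at this
  linarith

/-- The plane chart `ζ ↦ x₀ + (re ζ, im ζ)`. -/
def planeChart (x₀ : E2) : ℂ ≃ᵢ E2 :=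
  Complex.orthonormalBasisOneI.repr.toIsometryEquiv.trans (IsometryEquiv.addLeft x₀)

theorem planeChart_apply (x₀ : E2) (ζ : ℂ) :
    planeChart x₀ ζ = x₀ + Complex.orthonormalBasisOneI.repr ζ := rfl

theorem orthonormalBasisOneI_repr_one :
    Complex.orthonormalBasisOneI.repr (1 : ℂ) = EuclideanSpace.single (0 : Fin 2) 1 := by
  have := Complex.orthonormalBasisOneI.repr_self 0
  simpa using this

theorem orthonormalBasisOneI_repr_I :
    Complex.orthonormalBasisOneI.repr Complex.I = EuclideanSpace.single (1 : Fin 2) 1 := by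
  have := Complex.orthonormalBasisOneI.repr_self 1
  simpa using this

theorem fderiv_comp_planeChart (φ : E2 → ℝ) (x₀ : E2) (ζ a : ℂ) :
    fderiv ℝ (φ ∘ planeChart x₀) ζ a =
      fderiv ℝ φ (planeChart x₀ ζ) (Complex.orthonormalBasisOneI.repr a) := by
  have : φ ∘ planeChart x₀ =
      (fun y => φ (x₀ + y)) ∘ Complex.orthonormalBasisOneI.repr.toContinuousLinearEquiv := rfl
  rw [this, ContinuousLinearEquiv.comp_right_fderiv, fderiv_comp_add_left]
  rfl

theorem fderiv_fderiv_comp_planeChart (φ : E2 → ℝ) (x₀ : E2) (ζ a b : ℂ) :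
    fderiv ℝ (fun y => fderiv ℝ (φ ∘ planeChart x₀) y b) ζ a =
      fderiv ℝ (fun y => fderiv ℝ φ y (Complex.orthonormalBasisOneI.repr b)) (planeChart x₀ ζ)
        (Complex.orthonormalBasisOneI.repr a) := by
  rw [← fderiv_comp_planeChart]
  congr 2
  funext y
  exact fderiv_comp_planeChart φ x₀ y b

theorem contDiffAt_comp_planeChart {φ : E2 → ℝ} {x₀ : E2} {ζ : ℂ}
    (h : ContDiffAt ℝ 2 φ (planeChart x₀ ζ)) : ContDiffAt ℝ 2 (φ ∘ planeChart x₀) ζ := by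
  refine ContDiffAt.comp ζ h ?_
  exact contDiffAt_const.add
    Complex.orthonormalBasisOneI.repr.toContinuousLinearEquiv.contDiff.contDiffAt

theorem laplacian_comp_planeChart {φ : E2 → ℝ} {x₀ : E2} {ζ : ℂ}
    (h : ContDiffAt ℝ 2 φ (planeChart x₀ ζ)) :
    Laplacian.laplacian (φ ∘ planeChart x₀) ζ = lap φ (planeChart x₀ ζ) := by
  have h' := contDiffAt_comp_planeChart h
  rw [InnerProductSpace.laplacian_eq_iteratedFDeriv_complexPlane]
  simp only [iteratedFDeriv_two_apply, Matrix.cons_val_zero, Matrix.cons_val_one]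
  rw [← fderiv_fderiv_apply_eq h', ← fderiv_fderiv_apply_eq h', fderiv_fderiv_comp_planeChart,
    fderiv_fderiv_comp_planeChart, orthonormalBasisOneI_repr_one, orthonormalBasisOneI_repr_I]
  rfl

theorem IsTorsion.comp_planeChart {U : Set E2} {φ : E2 → ℝ} (h : IsTorsion U φ) (x₀ : E2) :
    IsPlaneTorsion (planeChart x₀ ⁻¹' U) (φ ∘ planeChart x₀) := by
  have e1 := (planeChart x₀).toHomeomorph.preimage_closure U
  have e2 := (planeChart x₀).toHomeomorph.preimage_frontier U
  simp only [IsometryEquiv.coe_toHomeomorph] at e1 e2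
  refine ⟨?_, fun x hx => contDiffAt_comp_planeChart (h.2.1 _ hx), fun x hx => ?_, fun x hx => ?_⟩
  · rw [← e1]
    exact h.1.comp (planeChart x₀).continuous.continuousOn (mapsTo_preimage _ _)
  · rw [laplacian_comp_planeChart (h.2.1 _ hx)]
    exact h.2.2.1 _ hx
  · rw [← e2] at hx
    exact h.2.2.2 _ hx

/-- The complex derivative of `∂w` reads off the first row of the Hessian of `w`. -/
theorem hasDerivAt_cpartial_sub {φ ψ : E2 → ℝ} {x₀ : E2} {ζ : ℂ}
    (hφ : ContDiffAt ℝ 2 φ (planeChart x₀ ζ)) (hψ : ContDiffAt ℝ 2 ψ (planeChart x₀ ζ))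
    (hw : InnerProductSpace.HarmonicAt (φ ∘ planeChart x₀ - ψ ∘ planeChart x₀) ζ) :
    HasDerivAt (cpartial (φ ∘ planeChart x₀ - ψ ∘ planeChart x₀))
      (⟨pd2 φ (planeChart x₀ ζ) 0 0 - pd2 ψ (planeChart x₀ ζ) 0 0,
        pd2 ψ (planeChart x₀ ζ) 0 1 - pd2 φ (planeChart x₀ ζ) 0 1⟩ : ℂ) ζ := by
  have hd : DifferentiableAt ℂ (cpartial (φ ∘ planeChart x₀ - ψ ∘ planeChart x₀)) ζ :=
    HarmonicAt.differentiableAt_complex_partial hw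
  refine hd.hasDerivAt.congr_deriv ?_
  have hpd : ∀ b : ℂ, fderiv ℝ (fun y => fderiv ℝ (φ ∘ planeChart x₀ - ψ ∘ planeChart x₀) y b) ζ 1 =
      fderiv ℝ (fun y => fderiv ℝ φ y (Complex.orthonormalBasisOneI.repr b)) (planeChart x₀ ζ)
        (EuclideanSpace.single 0 1) -
      fderiv ℝ (fun y => fderiv ℝ ψ y (Complex.orthonormalBasisOneI.repr b)) (planeChart x₀ ζ)
        (EuclideanSpace.single 0 1) := by
    intro b
    have h1 := contDiffAt_comp_planeChart hφ
    have h2 := contDiffAt_comp_planeChart hψ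
    rw [← orthonormalBasisOneI_repr_one, ← fderiv_fderiv_comp_planeChart, ← fderiv_fderiv_comp_planeChart,
      fderiv_fderiv_apply_eq hw.1, fderiv_fderiv_apply_eq h1, fderiv_fderiv_apply_eq h2]
    have : fderiv ℝ (φ ∘ planeChart x₀ - ψ ∘ planeChart x₀) =ᶠ[𝓝 ζ]
        fderiv ℝ (φ ∘ planeChart x₀) - fderiv ℝ (ψ ∘ planeChart x₀) := by
      filter_upwards [h1.eventually (by simp), h2.eventually (by simp)] with y hy1 hy2
      exact fderiv_sub (hy1.differentiableAt two_ne_zero) (hy2.differentiableAt two_ne_zero)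
    rw [this.fderiv_eq, fderiv_sub
      ((h1.fderiv_right (m := 1) (by norm_num)).differentiableAt one_ne_zero)
      ((h2.fderiv_right (m := 1) (by norm_num)).differentiableAt one_ne_zero)]
    rfl
  have hdd : ∀ b : ℂ, DifferentiableAt ℝ
      (fun y => fderiv ℝ (φ ∘ planeChart x₀ - ψ ∘ planeChart x₀) y b) ζ := fun b =>
    ((hw.1.fderiv_right (m := 1) (by norm_num)).differentiableAt one_ne_zero).clm_apply
      (differentiableAt_const b)
  have hreal : HasFDerivAt (cpartial (φ ∘ planeChart x₀ - ψ ∘ planeChart x₀))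
      (Complex.ofRealCLM.comp (fderiv ℝ (fun y =>
          fderiv ℝ (φ ∘ planeChart x₀ - ψ ∘ planeChart x₀) y 1) ζ) -
        Complex.I • Complex.ofRealCLM.comp (fderiv ℝ (fun y =>
          fderiv ℝ (φ ∘ planeChart x₀ - ψ ∘ planeChart x₀) y Complex.I) ζ)) ζ :=
    (Complex.ofRealCLM.hasFDerivAt.comp ζ (hdd 1).hasFDerivAt).sub
      ((Complex.ofRealCLM.hasFDerivAt.comp ζ (hdd Complex.I).hasFDerivAt).const_smul Complex.I)
  have huniq := hreal.unique (hd.hasDerivAt.hasFDerivAt.restrictScalars ℝ)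
  have := DFunLike.congr_fun huniq 1
  simp only [sub_apply, smul_apply,
    ContinuousLinearMap.comp_apply, hpd, orthonormalBasisOneI_repr_one, orthonormalBasisOneI_repr_I] at this
  simp at this
  rw [← this]
  apply Complex.ext <;> simp [pd2]

/-- The first derivatives near a critical point, rescaled, converge to the Hessian applied to
the limit direction. -/
theorem tendsto_fderiv_div_norm {ι : Type*} {l : Filter ι} {u : E2 → ℝ} {x₀ v a : E2} {y : ι → E2}
    (h : ContDiffAt ℝ 2 u x₀) (hcrit : fderiv ℝ u x₀ = 0) (hy : Tendsto y l (𝓝 x₀))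
    (hdir : Tendsto (fun i => ‖y i - x₀‖⁻¹ • (y i - x₀)) l (𝓝 v)) :
    Tendsto (fun i => fderiv ℝ u (y i) a / ‖y i - x₀‖) l
      (𝓝 (fderiv ℝ (fderiv ℝ u) x₀ v a)) := by
  have hd : HasFDerivAt (fderiv ℝ u) (fderiv ℝ (fderiv ℝ u) x₀) x₀ :=
    ((h.fderiv_right (m := 1) (by norm_num)).differentiableAt one_ne_zero).hasFDerivAt
  have ho : Tendsto (fun i => ‖y i - x₀‖⁻¹ • (fderiv ℝ u (y i) - fderiv ℝ u x₀ -
      fderiv ℝ (fderiv ℝ u) x₀ (y i - x₀))) l (𝓝 0) :=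
    (hd.isLittleO.comp_tendsto hy).norm_right.tendsto_inv_smul_nhds_zero
  have hs := ho.add (((fderiv ℝ (fderiv ℝ u) x₀).continuous.tendsto v).comp hdir)
  rw [zero_add] at hs
  refine ((ContinuousLinearMap.apply ℝ ℝ a).continuous.tendsto _ |>.comp hs).congr fun i => ?_
  simp [hcrit, div_eq_inv_mul]
  ring

theorem det_limit_neg {a b d p q r s l₁ l₂ : ℝ} (hl : l₁ < l₂) (hl₂ : l₂ < 0)
    (hv : p ^ 2 + q ^ 2 = 1) (hv' : r ^ 2 + s ^ 2 = 1) (ho : p * r + q * s = 0)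
    (h1 : a * p + b * q = l₁ * p) (h2 : b * p + d * q = l₁ * q)
    (h3 : a * r + b * s = l₂ * r) (h4 : b * r + d * s = l₂ * s) :
    (a + l₁ * (p ^ 2 - q ^ 2)) * (d - l₁ * (p ^ 2 - q ^ 2)) - (b + l₁ * (2 * p * q)) ^ 2 < 0 := by
  have hr : r = -(p * s - q * r) * q := by linear_combination p * ho - r * hv
  have hs : s = (p * s - q * r) * p := by linear_combination q * ho - s * hv
  have hk : (p * s - q * r) ^ 2 = 1 := by
    linear_combination (-(p * r + q * s)) * ho + (r ^ 2 + s ^ 2) * hv + hv'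
  generalize p * s - q * r = k at hr hs hk
  have hk0 : k ≠ 0 := by rintro rfl; norm_num at hk
  have h3' : -a * q + b * p = -l₂ * q := by
    apply mul_left_cancel₀ hk0; rw [hr, hs] at h3; linear_combination h3
  have h4' : -b * q + d * p = l₂ * p := by
    apply mul_left_cancel₀ hk0; rw [hr, hs] at h4; linear_combination h4
  have ea : a = l₁ * p ^ 2 + l₂ * q ^ 2 := by linear_combination p * h1 - q * h3' - a * hv
  have eb : b = (l₁ - l₂) * (p * q) := by linear_combination q * h1 + p * h3' - b * hv
  have ed : d = l₁ * q ^ 2 + l₂ * p ^ 2 := by linear_combination q * h2 + p * h4' - d * hv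
  have : (a + l₁ * (p ^ 2 - q ^ 2)) * (d - l₁ * (p ^ 2 - q ^ 2)) - (b + l₁ * (2 * p * q)) ^ 2 =
      2 * l₁ * (l₂ - l₁) := by
    rw [ea, eb, ed]
    linear_combination (2 * l₁ * (l₂ - l₁)) * (p ^ 2 + q ^ 2 + 1) * hv
  rw [this]
  nlinarith


/-- If `λ₁ < λ₂` and `z_ε` are critical points of `u_ε` along the `λ₁`-eigendirection,
then for small `ε`, `det D²u_ε(z_ε) < 0`: `z_ε` is a saddle point and not a local maximum. -/
theorem critical_point_is_saddle
    (Ω : Set E2) (hΩo : IsOpen Ω) (hΩb : Bornology.IsBounded Ω) (hΩc : Convex ℝ Ω)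
    (u₀ : E2 → ℝ) (h₀ : IsTorsion Ω u₀) (h₀pos : ∀ x ∈ Ω, 0 < u₀ x)
    (y₀ : E2) (hy₀ : y₀ ∈ Ω) (hy₀crit : gradient u₀ y₀ = 0)
    (hy₀uniq : ∀ x ∈ Ω, gradient u₀ x = 0 → x = y₀)
    (hy₀max : IsMaxOn u₀ Ω y₀)
    (x₀ : E2) (hx₀ : x₀ ∈ Ω) (heq : x₀ = y₀)
    (l₁ l₂ : ℝ) (hl₁₂ : l₁ < l₂) (hl₂ : l₂ < 0)
    (v₁ : E2) (hv₁ : ‖v₁‖ = 1)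
    (heig₁ : (Hess u₀ x₀).mulVec (fun i => v₁ i) = fun i => l₁ * v₁ i)
    (heig₂ : ∃ v₂ : E2, ‖v₂‖ = 1 ∧ v₁ 0 * v₂ 0 + v₁ 1 * v₂ 1 = 0 ∧
      (Hess u₀ x₀).mulVec (fun i => v₂ i) = fun i => l₂ * v₂ i)
    (ε₁ : ℝ) (hε₁ : 0 < ε₁) (hball : closedBall x₀ ε₁ ⊆ Ω)
    (uε : ℝ → E2 → ℝ) (zε : ℝ → E2)
    (huε : ∀ ε ∈ Ioo (0:ℝ) ε₁, IsTorsion (Ω \ closedBall x₀ ε) (uε ε))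
    (hzε : ∀ ε ∈ Ioo (0:ℝ) ε₁, zε ε ∈ Ω \ closedBall x₀ ε ∧ gradient (uε ε) (zε ε) = 0)
    (hdist : Tendsto (fun ε => |Real.log ε| * ‖zε ε - x₀‖ ^ 2) (𝓝[>] (0:ℝ))
      (𝓝 (-u₀ x₀ / l₁)))
    (hdir : Tendsto (fun ε => ‖zε ε - x₀‖⁻¹ • (zε ε - x₀)) (𝓝[>] (0:ℝ)) (𝓝 v₁)) :
    ∃ ε₀ > 0, ε₀ ≤ ε₁ ∧ ∀ ε ∈ Ioo (0:ℝ) ε₀,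
      (Hess (uε ε) (zε ε)).det < 0 ∧ ¬ IsLocalMax (uε ε) (zε ε) := by
  subst heq
  set T := planeChart x₀ with hT
  have hT0 : T 0 = x₀ := by simp [hT, planeChart_apply]
  have hTs : T.symm x₀ = 0 := by rw [← hT0]; exact T.symm_apply_apply 0
  have hTz : ∀ ε, T (T.symm (zε ε)) = zε ε := fun ε => T.apply_symm_apply _
  have hTd : ∀ y, T.symm y = Complex.orthonormalBasisOneI.repr.symm (y - x₀) := fun y => by
    apply T.injective
    rw [T.apply_symm_apply, hT, planeChart_apply, LinearIsometryEquiv.apply_symm_apply,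
      add_sub_cancel]
  have hnorm : ∀ y, ‖T.symm y‖ = ‖y - x₀‖ := fun y => by
    rw [hTd, LinearIsometryEquiv.norm_map]
  have hpre : ∀ ε, T ⁻¹' (closedBall x₀ ε) = closedBall 0 ε := fun ε => by
    rw [IsometryEquiv.preimage_closedBall, hTs]
  have hl₁ : l₁ < 0 := hl₁₂.trans hl₂
  have hc : 0 < -u₀ x₀ / l₁ := div_pos_of_neg_of_neg (neg_neg_of_pos (h₀pos x₀ hx₀)) hl₁
  have hsmall : ∀ᶠ ε in 𝓝[>] (0 : ℝ), ε ∈ Ioo 0 ε₁ := Ioo_mem_nhdsGT hε₁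
  have hzpos : ∀ ε ∈ Ioo 0 ε₁, 0 < ‖zε ε - x₀‖ := fun ε hε => by
    have := (hzε ε hε).1.2
    rw [mem_closedBall, dist_eq_norm, not_le] at this
    exact hε.1.trans this
  have hfd₀ : fderiv ℝ u₀ x₀ = 0 := by simpa [gradient] using hy₀crit
  have hfdε : ∀ ε ∈ Ioo 0 ε₁, fderiv ℝ (uε ε) (zε ε) = 0 := fun ε hε => by
    simpa [gradient] using (hzε ε hε).2
  have hC₀ := h₀.2.1 x₀ hx₀
  have hCz : ∀ ε ∈ Ioo 0 ε₁, ContDiffAt ℝ 2 u₀ (zε ε) := fun ε hε => h₀.2.1 _ (hzε ε hε).1.1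
  have hCε : ∀ ε ∈ Ioo 0 ε₁, ContDiffAt ℝ 2 (uε ε) (zε ε) := fun ε hε =>
    (huε ε hε).2.1 _ (hzε ε hε).1
  have hv : ∀ ε ∈ Ioo 0 ε₁,
      IsPlaneTorsion (T ⁻¹' Ω \ closedBall 0 ε) (uε ε ∘ T) := fun ε hε => by
    have := (huε ε hε).comp_planeChart x₀
    rwa [preimage_sdiff, hpre] at this
  have hz : ∀ ε ∈ Ioo 0 ε₁, T.symm (zε ε) ∈ T ⁻¹' Ω \ closedBall 0 ε := fun ε hε => by
    rw [← hpre, ← preimage_sdiff, mem_preimage, hTz]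
    exact (hzε ε hε).1
  have hΩo' : IsOpen (T ⁻¹' Ω) := hΩo.preimage T.continuous
  have hlim := tendsto_deriv_mul_cpartial_div (z := fun ε => T.symm (zε ε)) hΩo'
    (T.isometry.antilipschitz.isBounded_preimage hΩb) (h₀.comp_planeChart x₀)
    (fun x hx => h₀pos _ hx)
    (fun x hx => by simpa only [Function.comp, ← hT, hT0] using isMaxOn_iff.1 hy₀max _ hx) hε₁
    (by rw [← hpre]; exact preimage_mono hball) hv hz hc (by simpa only [hnorm] using hdist)
  have hr0 : Tendsto (fun ε => ‖zε ε - x₀‖) (𝓝[>] 0) (𝓝 0) :=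
    (tendsto_of_log_mul_sq hc (hsmall.mono hzpos) hdist).1
  have hzt : Tendsto zε (𝓝[>] 0) (𝓝 x₀) := tendsto_iff_norm_sub_tendsto_zero.2 hr0
  set p := v₁ 0 with hp
  set q := v₁ 1 with hq
  have hpq : p ^ 2 + q ^ 2 = 1 := by
    have := EuclideanSpace.norm_sq_eq v₁
    rw [hv₁] at this
    simpa [Fin.sum_univ_two] using this.symm
  have hvs : v₁ = p • EuclideanSpace.single 0 1 + q • EuclideanSpace.single 1 1 := by
    ext i; fin_cases i <;> simp [hp, hq]
  have hrow : ∀ i, pd2 u₀ x₀ i 0 * p + pd2 u₀ x₀ i 1 * q = l₁ * v₁ i := fun i => by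
    simpa [Matrix.mulVec, dotProduct, Fin.sum_univ_two, Hess] using congrFun heig₁ i
  have hgrad : ∀ j : Fin 2, Tendsto (fun ε => fderiv ℝ u₀ (zε ε) (EuclideanSpace.single j 1) /
      ‖zε ε - x₀‖) (𝓝[>] 0) (𝓝 (l₁ * v₁ j)) := fun j => by
    have := tendsto_fderiv_div_norm (a := EuclideanSpace.single j 1) hC₀ hfd₀ hzt hdir
    convert this using 2
    rw [hvs]
    simp only [map_add, map_smul, add_apply, smul_apply, smul_eq_mul, ← pd2_eq hC₀]
    rw [← hvs, ← hrow j, pd2_comm hC₀ j 0, pd2_comm hC₀ j 1]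
    ring
  have hw : ∀ ε ∈ Ioo 0 ε₁,
      InnerProductSpace.HarmonicAt (u₀ ∘ T - uε ε ∘ T) (T.symm (zε ε)) := fun ε hε => by
    have := ((h₀.comp_planeChart x₀).harmonicContOnCl_sub (hv ε hε)
      (hΩo'.sdiff isClosed_closedBall) sdiff_subset)
    exact this.1 _ (hz ε hε)
  have hcp : ∀ ε ∈ Ioo 0 ε₁, HasDerivAt (cpartial (u₀ ∘ T - uε ε ∘ T))
      (⟨pd2 u₀ (zε ε) 0 0 - pd2 (uε ε) (zε ε) 0 0,
        pd2 (uε ε) (zε ε) 0 1 - pd2 u₀ (zε ε) 0 1⟩ : ℂ) (T.symm (zε ε)) := fun ε hε => by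
    have h1 : ContDiffAt ℝ 2 u₀ (planeChart x₀ (T.symm (zε ε))) := by
      rw [← hT, hTz]; exact hCz ε hε
    have h2 : ContDiffAt ℝ 2 (uε ε) (planeChart x₀ (T.symm (zε ε))) := by
      rw [← hT, hTz]; exact hCε ε hε
    have := hasDerivAt_cpartial_sub h1 h2 (hw ε hε)
    rwa [← hT, hTz] at this
  have hval : ∀ ε ∈ Ioo 0 ε₁, cpartial (u₀ ∘ T - uε ε ∘ T) (T.symm (zε ε)) =
      fderiv ℝ u₀ (zε ε) (EuclideanSpace.single 0 1) -
        Complex.I * fderiv ℝ u₀ (zε ε) (EuclideanSpace.single 1 1) := fun ε hε => by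
    have h1 : DifferentiableAt ℝ (u₀ ∘ T) (T.symm (zε ε)) :=
      (contDiffAt_comp_planeChart (by rw [← hT, hTz]; exact hCz ε hε)).differentiableAt two_ne_zero
    have h2 : DifferentiableAt ℝ (uε ε ∘ T) (T.symm (zε ε)) :=
      (contDiffAt_comp_planeChart (by rw [← hT, hTz]; exact hCε ε hε)).differentiableAt two_ne_zero
    rw [cpartial, fderiv_sub h1 h2]
    simp only [sub_apply, hT, fderiv_comp_planeChart]
    rw [← hT, hTz, hfdε ε hε, orthonormalBasisOneI_repr_one, orthonormalBasisOneI_repr_I]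
    simp
  have hfr : Tendsto (fun ε => cpartial (u₀ ∘ T - uε ε ∘ T) (T.symm (zε ε)) /
      (‖zε ε - x₀‖ : ℂ)) (𝓝[>] 0) (𝓝 ((l₁ * p : ℝ) - Complex.I * (l₁ * q : ℝ))) := by
    refine (((Complex.continuous_ofReal.tendsto _).comp (hgrad 0)).sub
      (((Complex.continuous_ofReal.tendsto _).comp (hgrad 1)).const_mul Complex.I)).congr' ?_
    filter_upwards [hsmall] with ε hε
    rw [hval ε hε]
    simp only [Function.comp, Complex.ofReal_div]
    ring
  have hzr : Tendsto (fun ε => T.symm (zε ε) / (‖zε ε - x₀‖ : ℂ)) (𝓝[>] 0)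
      (𝓝 (p + q * Complex.I)) := by
    have := (Complex.orthonormalBasisOneI.repr.symm.continuous.tendsto v₁).comp hdir
    have e : Complex.orthonormalBasisOneI.repr.symm v₁ = p + q * Complex.I := by
      rw [hvs, map_add, map_smul, map_smul, ← orthonormalBasisOneI_repr_one, ← orthonormalBasisOneI_repr_I,
        LinearIsometryEquiv.symm_apply_apply, LinearIsometryEquiv.symm_apply_apply]
      simp
    rw [e] at this
    refine this.congr fun ε => ?_
    simp only [Function.comp, map_smul, hTd, Complex.real_smul, Complex.ofReal_inv]
    ring
  have hpqI : ((p : ℂ) - q * Complex.I) * (p + q * Complex.I) = 1 := by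
    have : ((p ^ 2 + q ^ 2 : ℝ) : ℂ) = 1 := by rw [hpq]; simp
    push_cast at this
    linear_combination this - q ^ 2 * Complex.I_sq
  have hne : (p : ℂ) + q * Complex.I ≠ 0 := right_ne_zero_of_mul_eq_one hpqI
  have hfz : Tendsto (fun ε => cpartial (u₀ ∘ T - uε ε ∘ T) (T.symm (zε ε)) / T.symm (zε ε))
      (𝓝[>] 0) (𝓝 (l₁ * (p - q * Complex.I) ^ 2)) := by
    have := hfr.div hzr hne
    have e : ((l₁ * p : ℝ) - Complex.I * (l₁ * q : ℝ)) / (p + q * Complex.I) =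
        l₁ * (p - q * Complex.I) ^ 2 := by
      rw [div_eq_iff hne]
      push_cast
      linear_combination (-l₁ * (p - q * Complex.I)) * hpqI
    rw [e] at this
    refine this.congr' ?_
    filter_upwards [hsmall] with ε hε
    exact div_div_div_cancel_right₀ (by exact_mod_cast (hzpos ε hε).ne') _ _
  have hf' : Tendsto (fun ε => (⟨pd2 u₀ (zε ε) 0 0 - pd2 (uε ε) (zε ε) 0 0,
      pd2 (uε ε) (zε ε) 0 1 - pd2 u₀ (zε ε) 0 1⟩ : ℂ)) (𝓝[>] 0)
      (𝓝 (0 - l₁ * (p - q * Complex.I) ^ 2)) := by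
    refine (hlim.sub hfz).congr' ?_
    filter_upwards [hsmall] with ε hε
    have hz0 : T.symm (zε ε) ≠ 0 := by
      rw [← norm_pos_iff, hnorm]; exact hzpos ε hε
    have hd := ((hasDerivAt_id (T.symm (zε ε))).mul (hcp ε hε)).deriv
    have hd' : deriv (fun ζ => ζ * cpartial (u₀ ∘ T - uε ε ∘ T) ζ) (T.symm (zε ε)) = _ := hd
    simp only [id] at hd'
    rw [hd', ← sub_div, div_eq_iff hz0]
    ring
  have hre := (Complex.continuous_re.tendsto _).comp hf'
  have him := (Complex.continuous_im.tendsto _).comp hf'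
  have ere : (0 - l₁ * (p - q * Complex.I) ^ 2 : ℂ).re = -(l₁ * (p ^ 2 - q ^ 2)) := by
    simp [pow_two]
  have eim : (0 - l₁ * (p - q * Complex.I) ^ 2 : ℂ).im = l₁ * (2 * p * q) := by
    simp [pow_two]
    ring
  rw [ere] at hre
  rw [eim] at him
  have hcont : ∀ i j, Tendsto (fun ε => pd2 u₀ (zε ε) i j) (𝓝[>] 0) (𝓝 (pd2 u₀ x₀ i j)) := by
    intro i j
    have h1 : ContDiffAt ℝ 1 (fun y => fderiv ℝ u₀ y (EuclideanSpace.single j 1)) x₀ :=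
      (hC₀.fderiv_right (m := 1) (by norm_num)).clm_apply contDiffAt_const
    have h2 : ContinuousAt (fderiv ℝ (fun y => fderiv ℝ u₀ y (EuclideanSpace.single j 1))) x₀ :=
      (h1.fderiv_right (m := 0) (by norm_num)).continuousAt
    exact (h2.clm_apply continuousAt_const).tendsto.comp hzt
  have h00 : Tendsto (fun ε => pd2 (uε ε) (zε ε) 0 0) (𝓝[>] 0)
      (𝓝 (pd2 u₀ x₀ 0 0 + l₁ * (p ^ 2 - q ^ 2))) := by
    have := (hcont 0 0).sub hre
    rw [sub_neg_eq_add] at this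
    exact this.congr fun ε => by simp
  have h01 : Tendsto (fun ε => pd2 (uε ε) (zε ε) 0 1) (𝓝[>] 0)
      (𝓝 (pd2 u₀ x₀ 0 1 + l₁ * (2 * p * q))) :=
    ((hcont 0 1).add him).congr fun ε => by simp
  have hlap : pd2 u₀ x₀ 0 0 + pd2 u₀ x₀ 1 1 = -1 := h₀.2.2.1 x₀ hx₀
  have hdet : Tendsto (fun ε => (Hess (uε ε) (zε ε)).det) (𝓝[>] 0)
      (𝓝 ((pd2 u₀ x₀ 0 0 + l₁ * (p ^ 2 - q ^ 2)) * (pd2 u₀ x₀ 1 1 - l₁ * (p ^ 2 - q ^ 2)) -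
        (pd2 u₀ x₀ 0 1 + l₁ * (2 * p * q)) ^ 2)) := by
    have e : pd2 u₀ x₀ 1 1 - l₁ * (p ^ 2 - q ^ 2) =
        -1 - (pd2 u₀ x₀ 0 0 + l₁ * (p ^ 2 - q ^ 2)) := by linarith
    rw [e]
    refine ((h00.mul (h00.const_sub (-1))).sub (h01.pow 2)).congr' ?_
    filter_upwards [hsmall] with ε hε
    have hl : pd2 (uε ε) (zε ε) 0 0 + pd2 (uε ε) (zε ε) 1 1 = -1 :=
      (huε ε hε).2.2.1 _ (hzε ε hε).1
    rw [Matrix.det_fin_two]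
    simp only [Hess, Matrix.of_apply]
    rw [pd2_comm (hCε ε hε) 1 0, ← eq_sub_iff_add_eq'.2 hl]
    ring
  have hneg : (pd2 u₀ x₀ 0 0 + l₁ * (p ^ 2 - q ^ 2)) * (pd2 u₀ x₀ 1 1 - l₁ * (p ^ 2 - q ^ 2)) -
      (pd2 u₀ x₀ 0 1 + l₁ * (2 * p * q)) ^ 2 < 0 := by
    obtain ⟨v₂, hv₂, horth, heig₂⟩ := heig₂
    have hrow₂ : ∀ i, pd2 u₀ x₀ i 0 * v₂ 0 + pd2 u₀ x₀ i 1 * v₂ 1 = l₂ * v₂ i := fun i => by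
      simpa [Matrix.mulVec, dotProduct, Fin.sum_univ_two, Hess] using congrFun heig₂ i
    have hrs : v₂ 0 ^ 2 + v₂ 1 ^ 2 = 1 := by
      have := EuclideanSpace.norm_sq_eq v₂
      rw [hv₂] at this
      simpa [Fin.sum_univ_two] using this.symm
    have hs := pd2_comm hC₀ 0 1
    exact det_limit_neg hl₁₂ hl₂ hpq hrs horth (hrow 0) (by rw [hs]; exact hrow 1) (hrow₂ 0)
      (by rw [hs]; exact hrow₂ 1)
  obtain ⟨δ, hδ, hδs⟩ := mem_nhdsGT_iff_exists_Ioo_subset.1 (hdet.eventually_lt_const hneg)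
  refine ⟨min δ ε₁, lt_min hδ hε₁, min_le_right _ _, fun ε hε => ?_⟩
  have h1 : (Hess (uε ε) (zε ε)).det < 0 := hδs ⟨hε.1, hε.2.trans_le (min_le_left _ _)⟩
  exact ⟨h1, not_isLocalMax_of_det_Hess_neg
    (hCε ε ⟨hε.1, hε.2.trans_le (min_le_right _ _)⟩) h1⟩
end
end

section
/- Suppose x₀ = y₀. For every constant C > 1 there exist c > 0 and ε₀ > 0 such that for all ε ∈ (0, ε₀) and all x ∈ Ω_ε with ε < |x − x₀| ≤ C·ε, one has |∇u_ε(x)| ≥ c/(ε·|log ε|); in particular u_ε has no critical points at distance of order ε from x₀. -/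
open Real Set Metric Filter Topology

noncomputable section

/-- `f` is `C²` at `x` with Laplacian `L` there. -/
def HasLapAt (f : E2 → ℝ) (x : E2) (L : ℝ) : Prop :=
  ContDiffAt ℝ 2 f x ∧ lap f x = L

lemma ContDiffAt.differentiableAt_fderiv_apply {f : E2 → ℝ} {x : E2}
    (hf : ContDiffAt ℝ 2 f x) (v : E2) :
    DifferentiableAt ℝ (fun y => fderiv ℝ f y v) x :=
  ((hf.fderiv_right (m := 1) (by norm_num)).differentiableAt one_ne_zero).clm_apply
    (differentiableAt_const v)

lemma ContDiffAt.eventually_differentiableAt_two {f : E2 → ℝ} {x : E2}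
    (hf : ContDiffAt ℝ 2 f x) : ∀ᶠ y in 𝓝 x, DifferentiableAt ℝ f y :=
  (hf.eventually (by simp)).mono fun _ hy => hy.differentiableAt two_ne_zero

lemma HasLapAt.add {f g : E2 → ℝ} {x : E2} {a b : ℝ} (hf : HasLapAt f x a)
    (hg : HasLapAt g x b) : HasLapAt (fun y => f y + g y) x (a + b) := by
  have key : ∀ i j, pd2 (fun y => f y + g y) x i j = pd2 f x i j + pd2 g x i j := by
    intro i j
    have h : (fun y => fderiv ℝ (fun z => f z + g z) y (EuclideanSpace.single j 1)) =ᶠ[𝓝 x]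
        fun y => fderiv ℝ f y (EuclideanSpace.single j 1)
          + fderiv ℝ g y (EuclideanSpace.single j 1) := by
      filter_upwards [hf.1.eventually_differentiableAt_two,
        hg.1.eventually_differentiableAt_two] with y h1 h2
      rw [fderiv_fun_add h1 h2]; rfl
    unfold pd2
    rw [h.fderiv_eq, fderiv_fun_add (hf.1.differentiableAt_fderiv_apply _)
      (hg.1.differentiableAt_fderiv_apply _)]
    rfl
  refine ⟨hf.1.add hg.1, ?_⟩
  rw [← hf.2, ← hg.2]
  simp only [lap, key]
  ring

lemma HasLapAt.const_mul {f : E2 → ℝ} {x : E2} {a : ℝ} (hf : HasLapAt f x a) (c : ℝ) :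
    HasLapAt (fun y => c * f y) x (c * a) := by
  have key : ∀ i j, pd2 (fun y => c * f y) x i j = c * pd2 f x i j := by
    intro i j
    have h : (fun y => fderiv ℝ (fun z => c * f z) y (EuclideanSpace.single j 1)) =ᶠ[𝓝 x]
        fun y => c * fderiv ℝ f y (EuclideanSpace.single j 1) := by
      filter_upwards [hf.1.eventually_differentiableAt_two] with y h1
      rw [fderiv_const_mul h1]; rfl
    unfold pd2
    rw [h.fderiv_eq, fderiv_const_mul (hf.1.differentiableAt_fderiv_apply _)]
    rfl
  refine ⟨contDiffAt_const.mul hf.1, ?_⟩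
  rw [← hf.2]
  simp only [lap, key]
  ring

lemma HasLapAt.sub {f g : E2 → ℝ} {x : E2} {a b : ℝ} (hf : HasLapAt f x a)
    (hg : HasLapAt g x b) : HasLapAt (fun y => f y - g y) x (a - b) := by
  simpa [sub_eq_add_neg] using hf.add (hg.const_mul (-1))

lemma hasLapAt_const (c : ℝ) (x : E2) : HasLapAt (fun _ => c) x 0 :=
  ⟨contDiffAt_const, by simp [lap, pd2]⟩

lemma HasLapAt.comp_homothety {f : E2 → ℝ} {x x₀ : E2} {a t : ℝ}
    (hf : HasLapAt f (x₀ + t • (x - x₀)) a) :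
    HasLapAt (fun y => f (x₀ + t • (y - x₀))) x (t ^ 2 * a) := by
  have hA : ∀ y, HasFDerivAt (fun y : E2 => x₀ + t • (y - x₀))
      (t • ContinuousLinearMap.id ℝ E2) y := fun y =>
    (((hasFDerivAt_id y).sub_const x₀).const_smul t).const_add x₀
  have hAc : ContDiff ℝ 2 (fun y : E2 => x₀ + t • (y - x₀)) := by fun_prop
  have key : ∀ i j, pd2 (fun y => f (x₀ + t • (y - x₀))) x i j
      = t ^ 2 * pd2 f (x₀ + t • (x - x₀)) i j := by
    intro i j
    have h : (fun y => fderiv ℝ (fun z => f (x₀ + t • (z - x₀))) y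
        (EuclideanSpace.single j 1)) =ᶠ[𝓝 x]
        fun y => t * fderiv ℝ f (x₀ + t • (y - x₀)) (EuclideanSpace.single j 1) := by
      have := (hAc.continuous.continuousAt (x := x)).eventually
        hf.1.eventually_differentiableAt_two
      filter_upwards [this] with y h1
      have h2 : HasFDerivAt (fun z => f (x₀ + t • (z - x₀)))
          ((fderiv ℝ f (x₀ + t • (y - x₀))).comp (t • ContinuousLinearMap.id ℝ E2)) y :=
        h1.hasFDerivAt.comp y (hA y)
      rw [h2.fderiv]
      simp
    have h2 : HasFDerivAt (fun y => fderiv ℝ f (x₀ + t • (y - x₀)) (EuclideanSpace.single j 1))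
        ((fderiv ℝ (fun y => fderiv ℝ f y (EuclideanSpace.single j 1)) (x₀ + t • (x - x₀))).comp
          (t • ContinuousLinearMap.id ℝ E2)) x :=
      HasFDerivAt.comp (g := fun y => fderiv ℝ f y (EuclideanSpace.single j 1)) x
        (hf.1.differentiableAt_fderiv_apply (EuclideanSpace.single j 1)).hasFDerivAt (hA x)
    unfold pd2
    rw [h.fderiv_eq, (h2.const_mul t).fderiv]
    simp
    ring
  refine ⟨ContDiffAt.comp x hf.1 hAc.contDiffAt, ?_⟩
  rw [← hf.2]
  simp only [lap, key]
  ring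

lemma hasFDerivAt_norm_sub_sq (x₀ y : E2) :
    HasFDerivAt (fun z : E2 => ‖z - x₀‖ ^ 2) (2 • innerSL ℝ (y - x₀)) y := by
  simpa using ((hasFDerivAt_id y).sub_const x₀).norm_sq

lemma hasFDerivAt_sub_coord (x₀ y : E2) (j : Fin 2) :
    HasFDerivAt (fun z : E2 => (z - x₀) j) (EuclideanSpace.proj j : E2 →L[ℝ] ℝ) y :=
  (EuclideanSpace.proj j : E2 →L[ℝ] ℝ).hasFDerivAt.comp y
    ((hasFDerivAt_id (𝕜 := ℝ) y).sub_const x₀)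

lemma hasLapAt_norm_sub_sq (x₀ x : E2) : HasLapAt (fun y => ‖y - x₀‖ ^ 2) x 4 := by
  refine ⟨((contDiff_id.sub contDiff_const).norm_sq ℝ).contDiffAt, ?_⟩
  have key : ∀ j, pd2 (fun y => ‖y - x₀‖ ^ 2) x j j = 2 := by
    intro j
    have h : (fun y => fderiv ℝ (fun z : E2 => ‖z - x₀‖ ^ 2) y (EuclideanSpace.single j 1))
        = fun y => 2 * (y - x₀) j := by
      ext y
      rw [(hasFDerivAt_norm_sub_sq x₀ y).fderiv]
      simp [EuclideanSpace.inner_single_right]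
    unfold pd2
    rw [h, ((hasFDerivAt_sub_coord x₀ x j).const_mul 2).fderiv]
    simp
  simp only [lap, key]
  norm_num

lemma hasLapAt_log_norm_sub_sq {x₀ x : E2} (hx : x ≠ x₀) :
    HasLapAt (fun y => Real.log (‖y - x₀‖ ^ 2)) x 0 := by
  have hpos : ∀ {y : E2}, y ≠ x₀ → ‖y - x₀‖ ^ 2 ≠ 0 := fun hy =>
    pow_ne_zero _ (norm_ne_zero_iff.2 (sub_ne_zero.2 hy))
  refine ⟨((contDiff_id.sub contDiff_const).norm_sq ℝ).contDiffAt.log (hpos hx), ?_⟩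
  have key : ∀ j, pd2 (fun y => Real.log (‖y - x₀‖ ^ 2)) x j j
      = 2 / ‖x - x₀‖ ^ 2 - 4 * ((x - x₀) j) ^ 2 / (‖x - x₀‖ ^ 2) ^ 2 := by
    intro j
    have h : (fun y => fderiv ℝ (fun z : E2 => Real.log (‖z - x₀‖ ^ 2)) y
        (EuclideanSpace.single j 1)) =ᶠ[𝓝 x]
        fun y => 2 * (y - x₀) j * (‖y - x₀‖ ^ 2)⁻¹ := by
      filter_upwards [isOpen_ne.mem_nhds hx] with y hy
      rw [((hasFDerivAt_norm_sub_sq x₀ y).log (hpos hy)).fderiv]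
      simp [EuclideanSpace.inner_single_right]
      ring
    have hd := ((hasFDerivAt_sub_coord x₀ x j).const_mul 2).mul
      ((hasDerivAt_inv (hpos hx)).comp_hasFDerivAt x (hasFDerivAt_norm_sub_sq x₀ x))
    unfold pd2
    rw [h.fderiv_eq]
    have := hd.fderiv
    simp only [Function.comp_def] at this
    change fderiv ℝ (fun y => 2 * (y - x₀) j * (‖y - x₀‖ ^ 2)⁻¹) x = _ at this
    rw [this]
    have h0 := hpos hx
    simp [EuclideanSpace.inner_single_right]
    field_simp
    ring
  simp only [lap, key]
  have h0 := hpos hx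
  have hn : ‖x - x₀‖ ^ 2 = (x - x₀) 0 ^ 2 + (x - x₀) 1 ^ 2 := by
    rw [EuclideanSpace.real_norm_sq_eq, Fin.sum_univ_two]
  rw [hn] at h0 ⊢
  field_simp
  ring

lemma IsLocalMax.pd2_nonpos {f : E2 → ℝ} {x : E2} (hf : ContDiffAt ℝ 2 f x)
    (hm : IsLocalMax f x) (j : Fin 2) : pd2 f x j j ≤ 0 := by
  by_contra! hpos
  set e : E2 := EuclideanSpace.single j 1
  set g : ℝ → ℝ := fun t => f (x + t • e)
  have hl : ∀ t : ℝ, HasDerivAt (fun t : ℝ => x + t • e) e t := fun t => by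
    simpa using ((hasDerivAt_id t).smul_const e).const_add x
  have hl0 : Tendsto (fun t : ℝ => x + t • e) (𝓝 0) (𝓝 x) := by
    have := (hl 0).continuousAt.tendsto
    simpa using this
  have hd : deriv g =ᶠ[𝓝 0] fun t => fderiv ℝ f (x + t • e) e := by
    filter_upwards [hl0.eventually hf.eventually_differentiableAt_two] with t ht
    exact (ht.hasFDerivAt.comp_hasDerivAt t (hl t)).deriv
  have hdd : deriv (deriv g) 0 = pd2 f x j j := by
    rw [hd.deriv_eq]
    have h2 : HasFDerivAt (fun y => fderiv ℝ f y e) (fderiv ℝ (fun y => fderiv ℝ f y e) x)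
        (x + (0 : ℝ) • e) := by
      simpa using (hf.differentiableAt_fderiv_apply e).hasFDerivAt
    exact (h2.comp_hasDerivAt 0 (hl 0)).deriv
  have hgm : IsLocalMax g 0 := by
    have := hl0.eventually hm
    simpa [IsLocalMax, IsMaxFilter, g] using this
  have hgc : ContinuousAt g 0 := by
    have : ContinuousAt f (x + (0 : ℝ) • e) := by simpa using hf.continuousAt
    exact ContinuousAt.comp this (hl 0).continuousAt
  have hmin := isLocalMin_of_deriv_deriv_pos (hdd ▸ hpos) hgm.deriv_eq_zero hgc
  have hc : g =ᶠ[𝓝 0] fun _ => g 0 := by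
    filter_upwards [hmin, hgm] with t h1 h2 using le_antisymm h2 h1
  have : deriv (deriv g) 0 = 0 := by
    rw [hc.deriv.deriv_eq]; simp
  linarith

lemma nonpos_of_subharmonic {D : Set E2} (hDo : IsOpen D) (hDb : Bornology.IsBounded D)
    {f : E2 → ℝ} (hfc : ContinuousOn f (closure D))
    (hf : ∀ x ∈ D, ∃ L, 0 ≤ L ∧ HasLapAt f x L)
    (hfr : ∀ x ∈ closure D, x ∉ D → f x ≤ 0) : ∀ x ∈ closure D, f x ≤ 0 := by
  intro x hx
  by_contra! hpos
  obtain ⟨B, hB⟩ := hDb.closure.exists_norm_le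
  have hB0 : 0 ≤ B := (norm_nonneg x).trans (hB x hx)
  set δ : ℝ := f x / (2 * (B ^ 2 + 1))
  have hδ : 0 < δ := by positivity
  obtain ⟨z, hz, hzm⟩ := hDb.isCompact_closure.exists_isMaxOn ⟨x, hx⟩
    (f := fun y => f y + δ * ‖y - 0‖ ^ 2) (hfc.add (by fun_prop))
  have hxz : f x + δ * ‖x - 0‖ ^ 2 ≤ f z + δ * ‖z - 0‖ ^ 2 := hzm hx
  by_cases hzD : z ∈ D
  · obtain ⟨L, hL, hfL⟩ := hf z hzD
    have hlap := hfL.add ((hasLapAt_norm_sub_sq 0 z).const_mul δ)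
    have hloc : IsLocalMax (fun y => f y + δ * ‖y - 0‖ ^ 2) z :=
      (hzm.on_subset subset_closure).isLocalMax (hDo.mem_nhds hzD)
    have h0 := hloc.pd2_nonpos hlap.1 0
    have h1 := hloc.pd2_nonpos hlap.1 1
    have := hlap.2
    unfold lap at this
    linarith
  · have h1 := hfr z hz hzD
    have h2 : ‖z - 0‖ ^ 2 ≤ B ^ 2 := by
      rw [sub_zero]; exact pow_le_pow_left₀ (norm_nonneg z) (hB z hz) 2
    have h3 : δ * ‖z - 0‖ ^ 2 ≤ δ * B ^ 2 := by gcongr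
    have h4 : δ * (2 * (B ^ 2 + 1)) = f x := by
      simp only [δ]; field_simp
    nlinarith [mul_nonneg hδ.le (sq_nonneg ‖x - 0‖), mul_nonneg hδ.le (sq_nonneg B)]

lemma IsTorsion.hasLapAt {U : Set E2} {u : E2 → ℝ} (hu : IsTorsion U u) {x : E2} (hx : x ∈ U) :
    HasLapAt u x (-1) :=
  ⟨hu.2.1 x hx, hu.2.2.1 x hx⟩

lemma IsTorsion.eq_zero {U : Set E2} {u : E2 → ℝ} (hU : IsOpen U) (hu : IsTorsion U u) {x : E2}
    (hx : x ∈ closure U) (hxU : x ∉ U) : u x = 0 :=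
  hu.2.2.2 x (by rw [hU.frontier_eq]; exact ⟨hx, hxU⟩)

lemma le_norm_sub_of_mem_closure {Ω : Set E2} {x₀ x : E2} {ε : ℝ}
    (hx : x ∈ closure (Ω \ closedBall x₀ ε)) : ε ≤ ‖x - x₀‖ := by
  refine closure_minimal (t := {y | ε ≤ ‖y - x₀‖}) ?_
    (isClosed_le continuous_const (by fun_prop)) hx
  rintro y ⟨-, hy⟩
  rw [mem_closedBall, dist_eq_norm, not_le] at hy
  exact hy.le

lemma norm_sub_eq_of_not_mem {Ω : Set E2} {x₀ x : E2} {ε : ℝ}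
    (hx : x ∈ closure (Ω \ closedBall x₀ ε)) (hxD : x ∉ Ω \ closedBall x₀ ε) (hxΩ : x ∈ Ω) :
    ‖x - x₀‖ = ε := by
  refine le_antisymm ?_ (le_norm_sub_of_mem_closure hx)
  by_contra! h
  exact hxD ⟨hxΩ, by rwa [mem_closedBall, dist_eq_norm, not_le]⟩

/-- Comparison with the torsion function of an annulus. -/
lemma IsTorsion.annulus_le {Ω : Set E2} (hΩo : IsOpen Ω) (hΩb : Bornology.IsBounded Ω)
    {x₀ : E2} {ε R k : ℝ} (hε : 0 < ε) (hεR : ε < R) (hball : closedBall x₀ R ⊆ Ω)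
    (hk0 : 0 ≤ k) (hk : k ≤ R ^ 2 / 2)
    (hkε : (R ^ 2 - ε ^ 2) / 4 + k * (Real.log (ε ^ 2) - Real.log (R ^ 2)) / 2 = 0)
    {u : E2 → ℝ} (hu : IsTorsion (Ω \ closedBall x₀ ε) u) :
    ∀ x ∈ closure (Ω \ closedBall x₀ ε),
      (R ^ 2 - ‖x - x₀‖ ^ 2) / 4
        + k * (Real.log (‖x - x₀‖ ^ 2) - Real.log (R ^ 2)) / 2 ≤ u x := by
  have hR : 0 < R := hε.trans hεR
  have hDo : IsOpen (Ω \ closedBall x₀ ε) := hΩo.sdiff isClosed_closedBall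
  have hne : ∀ x ∈ closure (Ω \ closedBall x₀ ε), 0 < ‖x - x₀‖ := fun x hx =>
    hε.trans_le (le_norm_sub_of_mem_closure hx)
  have key := nonpos_of_subharmonic hDo (hΩb.subset sdiff_subset)
    (f := fun x => ((k / 2 * Real.log (‖x - x₀‖ ^ 2) - 1 / 4 * ‖x - x₀‖ ^ 2)
      + (R ^ 2 / 4 - k * Real.log (R ^ 2) / 2)) - u x) ?_ ?_ ?_
  · intro x hx
    have := key x hx
    linarith
  · refine ContinuousOn.sub (ContinuousOn.add (ContinuousOn.sub (continuousOn_const.mul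
      (ContinuousOn.log (by fun_prop) fun x hx => (pow_pos (hne x hx) 2).ne')) (by fun_prop))
      continuousOn_const) hu.1
  · intro x hx
    have hx0 : x ≠ x₀ := fun h => by
      have := hne x (subset_closure hx)
      simp [h] at this
    refine ⟨_, ?_, ((((hasLapAt_log_norm_sub_sq hx0).const_mul _).sub
      ((hasLapAt_norm_sub_sq x₀ x).const_mul _)).add (hasLapAt_const _ x)).sub (hu.hasLapAt hx)⟩
    norm_num
  · intro x hx hxD
    rw [hu.eq_zero hDo hx hxD]
    by_cases hxΩ : x ∈ Ω
    · rw [norm_sub_eq_of_not_mem hx hxD hxΩ]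
      linarith
    · have hRx : R ≤ ‖x - x₀‖ := by
        by_contra! h
        exact hxΩ (hball (by rw [mem_closedBall, dist_eq_norm]; exact h.le))
      have hx2 : R ^ 2 ≤ ‖x - x₀‖ ^ 2 := by gcongr
      have hlog : Real.log (‖x - x₀‖ ^ 2) - Real.log (R ^ 2) ≤ ‖x - x₀‖ ^ 2 / R ^ 2 - 1 := by
        have hxp := pow_pos (hne x hx) 2
        rw [← Real.log_div hxp.ne' (by positivity)]
        exact Real.log_le_sub_one_of_pos (by positivity)
      have h1 : k * (Real.log (‖x - x₀‖ ^ 2) - Real.log (R ^ 2)) ≤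
          R ^ 2 / 2 * (‖x - x₀‖ ^ 2 / R ^ 2 - 1) := by
        have h0 : 0 ≤ ‖x - x₀‖ ^ 2 / R ^ 2 - 1 := by
          rw [sub_nonneg, one_le_div (by positivity)]; exact hx2
        exact (mul_le_mul_of_nonneg_left hlog hk0).trans (mul_le_mul_of_nonneg_right hk h0)
      have h2 : R ^ 2 / 2 * (‖x - x₀‖ ^ 2 / R ^ 2 - 1) = (‖x - x₀‖ ^ 2 - R ^ 2) / 2 := by
        field_simp
      linarith

/-- The slope of the annulus comparison function on the inner circle. -/
lemma IsTorsion.annulus_slope_le {Ω : Set E2} (hΩo : IsOpen Ω) (hΩb : Bornology.IsBounded Ω)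
    {x₀ : E2} {ε R k t : ℝ} (hε : 0 < ε) (hεR : ε < R) (hball : closedBall x₀ R ⊆ Ω)
    (hk0 : 0 ≤ k) (hk : k ≤ R ^ 2 / 2)
    (hkε : (R ^ 2 - ε ^ 2) / 4 + k * (Real.log (ε ^ 2) - Real.log (R ^ 2)) / 2 = 0)
    (ht : 1 < t) (ht2 : t < 2) {u : E2 → ℝ} (hu : IsTorsion (Ω \ closedBall x₀ ε) u)
    {y : E2} (hy : y ∈ Ω) (hyt : ‖y - x₀‖ = t * ε) :
    (t - 1) * (k / 2 - ε ^ 2) ≤ u y := by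
  have hmem : y ∈ Ω \ closedBall x₀ ε :=
    ⟨hy, by
      rw [mem_closedBall, dist_eq_norm, not_le, hyt]
      exact lt_mul_of_one_lt_left hε ht⟩
  have hA := hu.annulus_le hΩo hΩb hε hεR hball hk0 hk hkε _ (subset_closure hmem)
  rw [hyt, mul_pow, Real.log_mul (by positivity) (by positivity), Real.log_pow t 2] at hA
  push_cast at hA
  have hlogt : (t - 1) / 2 ≤ Real.log t := by
    have h1 := Real.one_sub_inv_le_log_of_pos (show 0 < t by linarith)
    have h2 : (t - 1) / 2 ≤ 1 - t⁻¹ := by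
      rw [show 1 - t⁻¹ = (t - 1) / t by field_simp]
      exact div_le_div_of_nonneg_left (by linarith) (by linarith) ht2.le
    linarith
  have h1 : k * ((t - 1) / 2) ≤ k * Real.log t := by gcongr
  have h2 : (t ^ 2 - 1) * ε ^ 2 ≤ 4 * (t - 1) * ε ^ 2 := by
    apply mul_le_mul_of_nonneg_right _ (sq_nonneg ε)
    linarith [mul_nonneg (show 0 ≤ t - 1 by linarith) (show 0 ≤ 3 - t by linarith)]
  linarith

lemma IsTorsion.le_of_sdiff {Ω : Set E2} (hΩo : IsOpen Ω) (hΩb : Bornology.IsBounded Ω)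
    {u₀ : E2 → ℝ} (h₀ : IsTorsion Ω u₀) (h₀pos : ∀ x ∈ Ω, 0 < u₀ x) {x₀ : E2} {ε : ℝ}
    {u : E2 → ℝ} (hu : IsTorsion (Ω \ closedBall x₀ ε) u) :
    ∀ x ∈ closure (Ω \ closedBall x₀ ε), u x ≤ u₀ x := by
  have hDo : IsOpen (Ω \ closedBall x₀ ε) := hΩo.sdiff isClosed_closedBall
  have hsub : closure (Ω \ closedBall x₀ ε) ⊆ closure Ω := closure_mono sdiff_subset
  have key := nonpos_of_subharmonic hDo (hΩb.subset sdiff_subset) (f := fun x => u x - u₀ x)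
    (hu.1.sub (h₀.1.mono hsub))
    (fun x hx => ⟨_, by norm_num, (hu.hasLapAt hx).sub (h₀.hasLapAt hx.1)⟩) ?_
  · intro x hx
    have := key x hx
    linarith
  · intro x hx hxD
    rw [hu.eq_zero hDo hx hxD]
    by_cases hxΩ : x ∈ Ω
    · linarith [h₀pos x hxΩ]
    · rw [h₀.eq_zero hΩo (hsub hx) hxΩ]; simp

/-- A decay estimate for `w = u₀ - u` under dilations about `x₀`, given on the inner circle,
propagates to the whole domain with a logarithmic profile. -/
lemma IsTorsion.dilation_estimate {Ω : Set E2} (hΩo : IsOpen Ω) (hΩb : Bornology.IsBounded Ω)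
    (hΩc : Convex ℝ Ω) {u₀ : E2 → ℝ} (h₀ : IsTorsion Ω u₀) (h₀pos : ∀ x ∈ Ω, 0 < u₀ x)
    {x₀ : E2} (hx₀ : x₀ ∈ Ω) {ε R M t : ℝ} (hε : 0 < ε) (hεR : 2 * ε < R)
    (hball : closedBall x₀ R ⊆ Ω) (hM : 0 ≤ M) (ht : 1 < t) (ht2 : t < 2)
    {u : E2 → ℝ} (hu : IsTorsion (Ω \ closedBall x₀ ε) u)
    (hin : ∀ x, ‖x - x₀‖ = ε →
      u₀ (x₀ + t • (x - x₀)) - u (x₀ + t • (x - x₀)) - u₀ x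
        + M * (Real.log ((R / 2) ^ 2) - Real.log (ε ^ 2)) ≤ 0)
    {x : E2} (hx : x₀ + t • (x - x₀) ∈ Ω) (hεx : ε < ‖x - x₀‖) :
    u₀ (x₀ + t • (x - x₀)) - u (x₀ + t • (x - x₀)) - (u₀ x - u x)
        + M * (Real.log ((R / 2) ^ 2) - Real.log (‖x - x₀‖ ^ 2)) ≤ 0 := by
  have ht0 : 0 < t := by linarith
  have hDo : IsOpen (Ω \ closedBall x₀ ε) := hΩo.sdiff isClosed_closedBall
  have hsub : closure (Ω \ closedBall x₀ ε) ⊆ closure Ω := closure_mono sdiff_subset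
  set H : E2 → E2 := fun y => x₀ + t • (y - x₀) with hH
  have hHc : Continuous H := by fun_prop
  have hHn : ∀ y, ‖H y - x₀‖ = t * ‖y - x₀‖ := fun y => by
    simp [hH, norm_smul, abs_of_pos ht0]
  have hHΩ : ∀ {y}, H y ∈ Ω → y ∈ Ω := fun {y} hy => by
    have := hΩc.add_smul_sub_mem hx₀ hy (t := t⁻¹) ⟨by positivity, inv_le_one_of_one_le₀ ht.le⟩
    simpa [hH, smul_smul, inv_mul_cancel₀ ht0.ne'] using this
  set D' : Set E2 := H ⁻¹' Ω ∩ {y | ε < ‖y - x₀‖} with hD'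
  have hD'o : IsOpen D' := (hΩo.preimage hHc).inter (isOpen_lt continuous_const (by fun_prop))
  have hD'D : D' ⊆ Ω \ closedBall x₀ ε := fun y hy =>
    ⟨hHΩ hy.1, by rw [mem_closedBall, dist_eq_norm, not_le]; exact hy.2⟩
  have hHD : MapsTo H D' (Ω \ closedBall x₀ ε) := fun y hy =>
    ⟨hy.1, by
      have h2 : ε < ‖y - x₀‖ := hy.2
      rw [mem_closedBall, dist_eq_norm, not_le, hHn]
      nlinarith⟩
  have hcl : closure D' ⊆ closure (Ω \ closedBall x₀ ε) := closure_mono hD'D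
  have hHcl : MapsTo H (closure D') (closure (Ω \ closedBall x₀ ε)) := hHD.closure hHc
  have hw : ContinuousOn (fun y => u₀ y - u y) (closure (Ω \ closedBall x₀ ε)) :=
    (h₀.1.mono hsub).sub hu.1
  have hwl : ∀ y ∈ Ω \ closedBall x₀ ε, HasLapAt (fun y => u₀ y - u y) y (-1 - -1) :=
    fun y hy => (h₀.hasLapAt hy.1).sub (hu.hasLapAt hy)
  refine nonpos_of_subharmonic hD'o ((hΩb.subset sdiff_subset).subset hD'D)
    (f := fun y => (u₀ (H y) - u (H y)) - (u₀ y - u y)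
        + M * (Real.log ((R / 2) ^ 2) - Real.log (‖y - x₀‖ ^ 2))) ?_ ?_ ?_ x
    (subset_closure ⟨hx, hεx⟩)
  · refine ((hw.comp hHc.continuousOn hHcl).sub (hw.mono hcl)).add
      (continuousOn_const.mul (continuousOn_const.sub (ContinuousOn.log (by fun_prop) ?_)))
    intro y hy
    exact (pow_pos (hε.trans_le (le_norm_sub_of_mem_closure (hcl hy))) 2).ne'
  · intro y hy
    have hy0 : y ≠ x₀ := fun h => by
      have : ε < ‖y - x₀‖ := hy.2
      simp [h] at this
      linarith
    refine ⟨_, ?_, (((hwl (H y) (hHD hy)).comp_homothety).sub (hwl y (hD'D hy))).add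
      (((hasLapAt_const _ y).sub (hasLapAt_log_norm_sub_sq hy0)).const_mul M)⟩
    norm_num
  · intro y hy hyD'
    have hyD := hcl hy
    have hεy := le_norm_sub_of_mem_closure hyD
    by_cases hHy : H y ∈ Ω
    · have hyε : ‖y - x₀‖ = ε := le_antisymm (not_lt.1 fun h => hyD' ⟨hHy, h⟩) hεy
      have huy : u y = 0 := hu.eq_zero hDo hyD fun h => h.2 (by
        rw [mem_closedBall, dist_eq_norm, hyε])
      have := hin y hyε
      simp only [huy, hyε, sub_zero]
      exact this
    · have hRy : R < t * ‖y - x₀‖ := by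
        by_contra! h
        exact hHy (hball (by rwa [mem_closedBall, dist_eq_norm, hHn]))
      have h1 : u₀ (H y) = 0 := h₀.eq_zero hΩo (hsub (hHcl hy)) hHy
      have h2 : u (H y) = 0 := hu.eq_zero hDo (hHcl hy) fun h => hHy h.1
      have h3 := h₀.le_of_sdiff hΩo hΩb h₀pos hu y hyD
      have h4 : Real.log ((R / 2) ^ 2) ≤ Real.log (‖y - x₀‖ ^ 2) := by
        apply Real.log_le_log (by nlinarith)
        have : R / 2 ≤ ‖y - x₀‖ := by nlinarith
        gcongr
        linarith
      have h5 : M * (Real.log ((R / 2) ^ 2) - Real.log (‖y - x₀‖ ^ 2)) ≤ 0 :=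
        mul_nonpos_of_nonneg_of_nonpos hM (by linarith)
      rw [h1, h2]
      linarith

lemma norm_homothety_sub (x₀ y : E2) {t : ℝ} (ht : 1 < t) :
    ‖x₀ + t • (y - x₀) - x₀‖ = t * ‖y - x₀‖ ∧
      ‖x₀ + t • (y - x₀) - y‖ = (t - 1) * ‖y - x₀‖ := by
  have h1 : x₀ + t • (y - x₀) - x₀ = t • (y - x₀) := by module
  have h2 : x₀ + t • (y - x₀) - y = (t - 1) • (y - x₀) := by module
  rw [h1, h2, norm_smul, norm_smul, Real.norm_of_nonneg (by linarith),
    Real.norm_of_nonneg (by linarith)]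
  exact ⟨rfl, rfl⟩

/-- Near the hole `u` increases under dilations about `x₀`. The constant `k` is the logarithmic
coefficient of the torsion function of the annulus of radii `ε` and `R`. -/
lemma IsTorsion.dilation_increment {Ω : Set E2} (hΩo : IsOpen Ω) (hΩb : Bornology.IsBounded Ω)
    (hΩc : Convex ℝ Ω) {u₀ : E2 → ℝ} (h₀ : IsTorsion Ω u₀) (h₀pos : ∀ x ∈ Ω, 0 < u₀ x)
    {x₀ : E2} (hx₀ : x₀ ∈ Ω) {ε R k K ρ C : ℝ} (hε : 0 < ε) (hC : 1 < C) (hCR : 2 * C * ε < R)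
    (hCρ : 2 * C * ε < ρ) (hCR2 : C ^ 2 * ε ≤ R / 2)
    (hball : closedBall x₀ R ⊆ Ω) (hk0 : 0 < k) (hk : k ≤ R ^ 2 / 2)
    (hkε : (R ^ 2 - ε ^ 2) / 4 + k * (Real.log (ε ^ 2) - Real.log (R ^ 2)) / 2 = 0)
    (hK : 0 ≤ K) (hLip : ∀ y z, ‖y - x₀‖ < ρ → ‖z - x₀‖ < ρ → |u₀ y - u₀ z| ≤ K * ‖y - z‖)
    (hsmall : ε ^ 2 + K * ε ≤ k / 4) (hsmall' : K * (C * ε) ≤ k / 16)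
    {u : E2 → ℝ} (hu : IsTorsion (Ω \ closedBall x₀ ε) u)
    {x : E2} (hεx : ε < ‖x - x₀‖) (hxC : ‖x - x₀‖ ≤ C * ε) {t : ℝ} (ht : 1 < t) (ht2 : t < 2) :
    (t - 1) * (k / 16) ≤ u (x₀ + t • (x - x₀)) - u x := by
  have hεC : ε < C * ε := lt_mul_of_one_lt_left hε hC
  have hR : 0 < R := by linarith
  have ht1 : 0 ≤ t - 1 := by linarith
  have hΩmem : ∀ {y : E2}, ‖y - x₀‖ ≤ R → y ∈ Ω := fun hy =>
    hball (by rwa [mem_closedBall, dist_eq_norm])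
  have hscale : ∀ {d : ℝ}, 0 ≤ d → d ≤ C * ε → t * d ≤ 2 * C * ε := fun hd h => by
    rw [mul_assoc]
    exact mul_le_mul ht2.le h hd zero_le_two
  have hlogR : Real.log (ε ^ 2) < Real.log ((R / 2) ^ 2) := by
    apply Real.log_lt_log (by positivity)
    have : ε < R / 2 := by linarith
    gcongr
  set M : ℝ := (t - 1) * (k / 4) / (Real.log ((R / 2) ^ 2) - Real.log (ε ^ 2))
  have hMlog : M * (Real.log ((R / 2) ^ 2) - Real.log (ε ^ 2)) = (t - 1) * (k / 4) :=
    div_mul_cancel₀ _ (by linarith)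
  have hM : 0 ≤ M := div_nonneg (mul_nonneg ht1 (by linarith)) (by linarith)
  obtain ⟨hn1, hn2⟩ := norm_homothety_sub x₀ x ht
  have htx : ‖x₀ + t • (x - x₀) - x₀‖ ≤ 2 * C * ε := by
    rw [hn1]
    exact hscale (norm_nonneg _) hxC
  have hin : ∀ y, ‖y - x₀‖ = ε →
      u₀ (x₀ + t • (y - x₀)) - u (x₀ + t • (y - x₀)) - u₀ y
      + M * (Real.log ((R / 2) ^ 2) - Real.log (ε ^ 2)) ≤ 0 := by
    intro y hy
    obtain ⟨hm1, hm2⟩ := norm_homothety_sub x₀ y ht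
    rw [hy] at hm1 hm2
    have hty := hscale hε.le hεC.le
    have hL := (le_abs_self _).trans
      (hLip (x₀ + t • (y - x₀)) y (by rw [hm1]; linarith) (by rw [hy]; linarith))
    rw [hm2] at hL
    have hA := hu.annulus_slope_le hΩo hΩb hε (by linarith) hball hk0.le hk hkε ht ht2
      (hΩmem (by rw [hm1]; linarith)) hm1
    rw [hMlog]
    have := mul_le_mul_of_nonneg_left hsmall ht1
    linarith
  have hD := h₀.dilation_estimate hΩo hΩb hΩc h₀pos hx₀ hε (by linarith) hball hM ht ht2
    hu hin (hΩmem (htx.trans hCR.le)) hεx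
  have hprof : (Real.log ((R / 2) ^ 2) - Real.log (ε ^ 2)) / 2 ≤
      Real.log ((R / 2) ^ 2) - Real.log (‖x - x₀‖ ^ 2) := by
    have hx0 : 0 < ‖x - x₀‖ := hε.trans hεx
    have h1 : Real.log ((‖x - x₀‖ ^ 2) ^ 2) ≤ Real.log ((R / 2) ^ 2) + Real.log (ε ^ 2) := by
      rw [← Real.log_mul (by positivity) (by positivity)]
      apply Real.log_le_log (by positivity)
      rw [← mul_pow]
      have : ‖x - x₀‖ ^ 2 ≤ R / 2 * ε := by
        calc ‖x - x₀‖ ^ 2 ≤ (C * ε) ^ 2 := by gcongr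
          _ = C ^ 2 * ε * ε := by ring
          _ ≤ R / 2 * ε := by gcongr
      gcongr
    rw [Real.log_pow (‖x - x₀‖ ^ 2) 2] at h1
    push_cast at h1
    linarith
  have hprof' := mul_le_mul_of_nonneg_left hprof hM
  have hL := (abs_le.1 (hLip (x₀ + t • (x - x₀)) x (by linarith) (by linarith))).1
  rw [hn2] at hL
  have hKx : (t - 1) * (K * ‖x - x₀‖) ≤ (t - 1) * (k / 16) :=
    mul_le_mul_of_nonneg_left ((mul_le_mul_of_nonneg_left hxC hK).trans hsmall') ht1
  linarith

/-- Gradient bound near the hole, with `k` as in `IsTorsion.dilation_increment`. -/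
lemma IsTorsion.norm_gradient_ge {Ω : Set E2} (hΩo : IsOpen Ω) (hΩb : Bornology.IsBounded Ω)
    (hΩc : Convex ℝ Ω) {u₀ : E2 → ℝ} (h₀ : IsTorsion Ω u₀) (h₀pos : ∀ x ∈ Ω, 0 < u₀ x)
    {x₀ : E2} (hx₀ : x₀ ∈ Ω) {ε R k K ρ C : ℝ} (hε : 0 < ε) (hC : 1 < C) (hCR : 2 * C * ε < R)
    (hCρ : 2 * C * ε < ρ) (hCR2 : C ^ 2 * ε ≤ R / 2)
    (hball : closedBall x₀ R ⊆ Ω) (hk0 : 0 < k) (hk : k ≤ R ^ 2 / 2)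
    (hkε : (R ^ 2 - ε ^ 2) / 4 + k * (Real.log (ε ^ 2) - Real.log (R ^ 2)) / 2 = 0)
    (hK : 0 ≤ K) (hLip : ∀ y z, ‖y - x₀‖ < ρ → ‖z - x₀‖ < ρ → |u₀ y - u₀ z| ≤ K * ‖y - z‖)
    (hsmall : ε ^ 2 + K * ε ≤ k / 4) (hsmall' : K * (C * ε) ≤ k / 16)
    {u : E2 → ℝ} (hu : IsTorsion (Ω \ closedBall x₀ ε) u)
    {x : E2} (hεx : ε < ‖x - x₀‖) (hxC : ‖x - x₀‖ ≤ C * ε) :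
    k / 16 / (C * ε) ≤ ‖gradient u x‖ := by
  have hεC : ε < C * ε := lt_mul_of_one_lt_left hε hC
  have hxD : x ∈ Ω \ closedBall x₀ ε :=
    ⟨hball (by rw [mem_closedBall, dist_eq_norm]; linarith), by rwa [mem_closedBall, dist_eq_norm, not_le]⟩
  have hdiff : DifferentiableAt ℝ u x := (hu.2.1 x hxD).differentiableAt two_ne_zero
  set g : ℝ → ℝ := fun t => u (x₀ + t • (x - x₀)) with hg
  have hg1 : g 1 = u x := by simp [hg]
  have hgd : HasDerivAt g (fderiv ℝ u x (x - x₀)) 1 := by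
    have hl : HasDerivAt (fun t : ℝ => x₀ + t • (x - x₀)) (x - x₀) 1 := by
      simpa using ((hasDerivAt_id (1 : ℝ)).smul_const (x - x₀)).const_add x₀
    have hu' : HasFDerivAt u (fderiv ℝ u x) (x₀ + (1 : ℝ) • (x - x₀)) := by
      simpa using hdiff.hasFDerivAt
    exact hu'.comp_hasDerivAt 1 hl
  have hder : k / 16 ≤ fderiv ℝ u x (x - x₀) := by
    refine ge_of_tendsto (hgd.tendsto_slope.mono_left
      (nhdsWithin_mono 1 (s := Ioi 1) fun t ht => ht.ne')) ?_
    filter_upwards [Ioo_mem_nhdsGT (show (1 : ℝ) < 2 by norm_num)] with t ht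
    rw [slope_def_field, le_div_iff₀ (by linarith [ht.1]), hg1, mul_comm]
    exact h₀.dilation_increment hΩo hΩb hΩc h₀pos hx₀ hε hC hCR hCρ hCR2 hball hk0 hk hkε hK hLip
      hsmall hsmall' hu hεx hxC ht.1 ht.2
  have hnorm : ‖gradient u x‖ = ‖fderiv ℝ u x‖ := by
    simp [gradient]
  rw [hnorm, div_le_iff₀ (by positivity)]
  calc k / 16 ≤ fderiv ℝ u x (x - x₀) := hder
    _ ≤ ‖fderiv ℝ u x (x - x₀)‖ := le_abs_self _
    _ ≤ ‖fderiv ℝ u x‖ * ‖x - x₀‖ := (fderiv ℝ u x).le_opNorm _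
    _ ≤ ‖fderiv ℝ u x‖ * (C * ε) := by gcongr

/-- The logarithmic coefficient of the torsion function of the annulus of radii `ε` and `R` is of
order `1 / |log ε|`. -/
lemma exists_annulus_coefficient {ε R : ℝ} (hε : 0 < ε) (hε1 : ε < 1) (hεR1 : R * ε < 1)
    (h4R : 4 * ε < R) :
    ∃ k, 0 < k ∧ k ≤ R ^ 2 / 2 ∧
      (R ^ 2 - ε ^ 2) / 4 + k * (Real.log (ε ^ 2) - Real.log (R ^ 2)) / 2 = 0 ∧
      R ^ 2 / (16 * |Real.log ε|) ≤ k := by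
  have hR : 0 < R := by linarith
  have hlogε : Real.log ε < 0 := Real.log_neg hε hε1
  have hlogR : Real.log R ≤ -Real.log ε := by
    have h := Real.log_neg (mul_pos hR hε) hεR1
    rw [Real.log_mul hR.ne' hε.ne'] at h
    linarith
  have hA : 1 / 2 ≤ Real.log R - Real.log ε := by
    have h1 := Real.one_sub_inv_le_log_of_pos (show 0 < R / ε by positivity)
    rw [Real.log_div hR.ne' hε.ne', inv_div] at h1
    have h2 : ε / R ≤ 1 / 4 := by rw [div_le_iff₀ hR]; linarith
    linarith
  have hεsq : ε ^ 2 ≤ R ^ 2 / 2 := by nlinarith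
  have hR2 : 0 < R ^ 2 := by positivity
  refine ⟨(R ^ 2 - ε ^ 2) / (4 * (Real.log R - Real.log ε)),
    div_pos (by linarith) (by linarith), ?_, ?_, ?_⟩
  · rw [div_le_iff₀ (by linarith)]
    nlinarith [sq_nonneg ε]
  · rw [Real.log_pow, Real.log_pow]
    have : Real.log R - Real.log ε ≠ 0 := by linarith
    push_cast
    field_simp
    ring
  · rw [abs_of_neg hlogε, div_le_div_iff₀ (by linarith) (by linarith)]
    nlinarith

/-- If `x₀ = y₀`, for every `C > 1` there is `c > 0` such that
`|∇u_ε(x)| ≥ c/(ε|log ε|)` whenever `ε < |x-x₀| ≤ Cε`: no critical points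
at distance of order `ε` from `x₀`. -/
theorem no_critical_points_at_scale_eps
    (Ω : Set E2) (hΩo : IsOpen Ω) (hΩb : Bornology.IsBounded Ω) (hΩc : Convex ℝ Ω)
    (u₀ : E2 → ℝ) (h₀ : IsTorsion Ω u₀) (h₀pos : ∀ x ∈ Ω, 0 < u₀ x)
    (y₀ : E2) (hy₀ : y₀ ∈ Ω) (hy₀crit : gradient u₀ y₀ = 0)
    (hy₀uniq : ∀ x ∈ Ω, gradient u₀ x = 0 → x = y₀)
    (hy₀max : IsMaxOn u₀ Ω y₀)
    (x₀ : E2) (hx₀ : x₀ ∈ Ω) (heq : x₀ = y₀)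
    (ε₁ : ℝ) (hε₁ : 0 < ε₁) (hball : closedBall x₀ ε₁ ⊆ Ω)
    (uε : ℝ → E2 → ℝ)
    (huε : ∀ ε ∈ Ioo (0:ℝ) ε₁, IsTorsion (Ω \ closedBall x₀ ε) (uε ε)) :
    ∀ C > 1, ∃ c > 0, ∃ ε₀ > 0, ε₀ ≤ ε₁ ∧ ∀ ε ∈ Ioo (0:ℝ) ε₀,
      ∀ x ∈ Ω \ closedBall x₀ ε, ε < ‖x - x₀‖ → ‖x - x₀‖ ≤ C * ε →
        c / (ε * |Real.log ε|) ≤ ‖gradient (uε ε) x‖ := by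
  intro C hC
  set R := ε₁
  obtain ⟨K, s, hs, hKs⟩ := ((h₀.2.1 x₀ hx₀).of_le (m := 1) (by norm_num)).exists_lipschitzOnWith
  obtain ⟨ρ, hρ, hρs⟩ := Metric.mem_nhds_iff.1 hs
  have hLip : ∀ y z, ‖y - x₀‖ < ρ → ‖z - x₀‖ < ρ → |u₀ y - u₀ z| ≤ K * ‖y - z‖ := by
    intro y z hy hz
    have := hKs.dist_le_mul y (hρs (by rwa [mem_ball, dist_eq_norm])) z
      (hρs (by rwa [mem_ball, dist_eq_norm]))
    rwa [Real.dist_eq, dist_eq_norm] at this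
  have hC0 : 0 < C := by linarith
  have hlin : ∀ a b : ℝ, 0 < b → ∀ᶠ ε in 𝓝[>] (0 : ℝ), a * ε < b := by
    intro a b hb
    have : Tendsto (fun ε : ℝ => a * ε) (𝓝[>] 0) (𝓝 (a * 0)) :=
      ((continuous_const_mul a).tendsto 0).mono_left nhdsWithin_le_nhds
    rw [mul_zero] at this
    exact this.eventually_lt_const hb
  have hlog : ∀ᶠ ε in 𝓝[>] (0 : ℝ), -(256 * (1 + K * C)) * (ε * Real.log ε) < R ^ 2 := by
    have h := ((continuous_const_mul (-(256 * (1 + K * C)) : ℝ)).comp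
      Real.continuous_mul_log).tendsto 0
    simp only [Function.comp_def, zero_mul, mul_zero] at h
    exact (h.mono_left nhdsWithin_le_nhds).eventually_lt_const (by positivity)
  have hall := (hlin (2 * C) R hε₁).and <| (hlin (2 * C) ρ hρ).and <|
    (hlin (C ^ 2) (R / 2) (by positivity)).and <| (hlin 1 1 one_pos).and <|
    (hlin R 1 one_pos).and <| (hlin 4 R hε₁).and hlog
  obtain ⟨ε₀, hε₀, hmem⟩ := mem_nhdsGT_iff_exists_Ioo_subset.1 hall
  refine ⟨R ^ 2 / (256 * C), by positivity, min ε₀ ε₁, lt_min hε₀ hε₁, min_le_right _ _, ?_⟩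
  rintro ε ⟨hε, hεlt⟩ x hx hεx hxC
  obtain ⟨hCR, hCρ, hCR2, hε1, hεR1, h4R, hsm⟩ := hmem ⟨hε, hεlt.trans_le (min_le_left _ _)⟩
  rw [one_mul] at hε1
  have hR : 0 < R := hε₁
  have hLneg : Real.log ε < 0 := Real.log_neg hε hε1
  obtain ⟨k, hk0, hk, hkε, hkL⟩ := exists_annulus_coefficient hε hε1 hεR1 h4R
  rw [abs_of_neg hLneg] at hkL ⊢
  have hLpos : 0 < -Real.log ε := by linarith
  have hsm' : (1 + K * C) * ε ≤ k / 16 := by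
    have : (1 + K * C) * ε ≤ R ^ 2 / (16 * -Real.log ε) / 16 := by
      rw [div_div, le_div_iff₀ (by positivity)]
      linarith
    linarith
  have hK0 : (0 : ℝ) ≤ K := K.coe_nonneg
  have hKCε : 0 ≤ (K : ℝ) * C * ε := by positivity
  have hKε : (K : ℝ) * ε ≤ K * C * ε := by
    have : (K : ℝ) ≤ K * C := le_mul_of_one_le_right hK0 hC.le
    gcongr
  have hmain := h₀.norm_gradient_ge hΩo hΩb hΩc h₀pos hx₀ hε hC hCR hCρ hCR2.le hball
    hk0 hk hkε hK0 hLip (by nlinarith) (by linarith)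
    (huε ε ⟨hε, hεlt.trans_le (min_le_right _ _)⟩) hεx hxC
  refine le_trans ?_ hmain
  calc R ^ 2 / (256 * C) / (ε * -Real.log ε) = R ^ 2 / (16 * -Real.log ε) / 16 / (C * ε) := by
        rw [div_div, div_div, div_div]
        congr 1
        ring
    _ ≤ k / 16 / (C * ε) := by gcongr
end
end
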